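/- Assume the Trudinger–Moser property holds with some constant ω ∈ (0,π] and that f satisfies hypotheses (H'). Then the problem (−Δ)^{1/2} u = f(u) in (0,1), u = 0 in ℝ∖(0,1) has a nontrivial weak solution, i.e. there exists u ∈ X with u ≠ 0 such that (1/(2π))⟨u,v⟩_X = ∫₀¹ f(u) v dx for all v ∈ X. -/

import Mathlib

open MeasureTheory Real Set Filter Topology

noncomputable section

/-- Integrand of the squared Gagliardo `H^{1/2}` seminorm on `ℝ`. -/
def gagKer (u : ℝ → ℝ) : ℝ × ℝ → ℝ :=
  fun p => (u p.1 - u p.2) ^ 2 / |p.1 - p.2| ^ 2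

/-- Integrand of the Gagliardo inner product `⟨u,v⟩_X`. -/
def innerKer (u v : ℝ → ℝ) : ℝ × ℝ → ℝ :=
  fun p => (u p.1 - u p.2) * (v p.1 - v p.2) / |p.1 - p.2| ^ 2

/-- `u ∈ H^{1/2}(ℝ)` : `u ∈ L²(ℝ)` with finite Gagliardo seminorm. -/
def memH (u : ℝ → ℝ) : Prop :=
  Measurable u ∧ Integrable (fun x => (u x) ^ 2) ∧ Integrable (gagKer u)

/-- Squared Gagliardo seminorm `[u]²`. -/
def gagSq (u : ℝ → ℝ) : ℝ := ∫ p : ℝ × ℝ, gagKer u p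

/-- Gagliardo seminorm `[u]`, i.e. the norm `‖u‖_X`. -/
def gagNorm (u : ℝ → ℝ) : ℝ := Real.sqrt (gagSq u)

/-- Inner product `⟨u, v⟩_X`. -/
def innerX (u v : ℝ → ℝ) : ℝ := ∫ p : ℝ × ℝ, innerKer u v p

/-- `u ∈ X` : `u ∈ H^{1/2}(ℝ)` and `u = 0` a.e. outside `(0,1)`. -/
def memX (u : ℝ → ℝ) : Prop :=
  memH u ∧ ∀ᵐ x : ℝ, x ∉ Ioo (0 : ℝ) 1 → u x = 0

/-- `λ₁ = inf {[u]² : u ∈ X, ‖u‖_{L²(0,1)} = 1}`. -/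
def lam1 : ℝ :=
  sInf { t : ℝ | ∃ u : ℝ → ℝ, memX u ∧ (∫ x in Ioo (0 : ℝ) 1, (u x) ^ 2) = 1 ∧ gagSq u = t }

/-- Trudinger–Moser property with constant `ω`. -/
def TMprop (ω : ℝ) : Prop :=
  ∀ α : ℝ, 0 < α → α < 2 * π * ω →
    ∃ K : ℝ, 0 < K ∧ ∀ u : ℝ → ℝ, memX u → gagNorm u ≤ 1 →
      (∫⁻ x in Ioo (0 : ℝ) 1, ENNReal.ofReal (exp (α * (u x) ^ 2))) ≤ ENNReal.ofReal K

/-- The primitive `F(t) = ∫₀ᵗ f(τ) dτ`. -/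
def primF (f : ℝ → ℝ) : ℝ → ℝ := fun t => ∫ τ in (0 : ℝ)..t, f τ

/-- Hypotheses (H). -/
def HypH (f : ℝ → ℝ) : Prop :=
  Continuous f ∧ f 0 = 0 ∧
  (∃ t₀ > (0 : ℝ), ∃ M > (0 : ℝ),
    ∀ t : ℝ, t₀ ≤ |t| → 0 < primF f t ∧ primF f t ≤ M * |f t|) ∧
  (∀ t : ℝ, t ≠ 0 → 0 < 2 * primF f t ∧ 2 * primF f t ≤ f t * t) ∧
  (Filter.limsup (fun t => primF f t / t ^ 2) (𝓝[≠] (0 : ℝ)) < lam1 / (4 * π)) ∧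
  (∀ α : ℝ, 0 < α →
    Filter.Tendsto (fun t => |f t| * exp (-α * t ^ 2)) (Filter.cocompact ℝ) (𝓝 0))

/-- Hypotheses (H') with Trudinger–Moser constant `ω`. -/
def HypH' (f : ℝ → ℝ) (ω : ℝ) : Prop :=
  Continuous f ∧ f 0 = 0 ∧
  (∃ t₀ > (0 : ℝ), ∃ M > (0 : ℝ),
    ∀ t : ℝ, t₀ ≤ |t| → 0 < primF f t ∧ primF f t ≤ M * |f t|) ∧
  (∀ t : ℝ, t ≠ 0 → 0 < 2 * primF f t ∧ 2 * primF f t ≤ f t * t) ∧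
  (Filter.limsup (fun t => primF f t / t ^ 2) (𝓝[≠] (0 : ℝ)) < lam1 / (4 * π)) ∧
  ∃ α₀ : ℝ, 0 < α₀ ∧ α₀ < 2 * π * ω ∧
    (∀ α : ℝ, 0 < α → α < α₀ →
      Filter.Tendsto (fun t => |f t| * exp (-α * t ^ 2)) (Filter.cocompact ℝ) Filter.atTop) ∧
    (∀ α : ℝ, α₀ < α →
      Filter.Tendsto (fun t => |f t| * exp (-α * t ^ 2)) (Filter.cocompact ℝ) (𝓝 0)) ∧
    ∃ ψ : ℝ → ℝ, memX ψ ∧ gagNorm ψ = 1 ∧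
      ∃ b : ℝ, b < ω / (2 * α₀) ∧ ∀ t : ℝ, 0 < t →
        t ^ 2 / (4 * π) - (∫ x in Ioo (0 : ℝ) 1, primF f (t * ψ x)) ≤ b

/-- `u` is a (weak) solution of `(-Δ)^{1/2} u = f(u)` in `(0,1)`, `u = 0` outside. -/
def IsWeakSolution (f u : ℝ → ℝ) : Prop :=
  memX u ∧ ∀ v : ℝ → ℝ, memX v →
    IntegrableOn (fun x => f (u x) * v x) (Ioo (0 : ℝ) 1) ∧
    innerX u v / (2 * π) = ∫ x in Ioo (0 : ℝ) 1, f (u x) * v x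

/-- The energy functional `φ(u) = ‖u‖_X²/(4π) - ∫₀¹ F(u) dx`. -/
def phi (f u : ℝ → ℝ) : ℝ :=
  gagSq u / (4 * π) - ∫ x in Ioo (0 : ℝ) 1, primF f (u x)

/-- `⟨φ'(u), v⟩ = (1/(2π))⟨u,v⟩_X - ∫₀¹ f(u) v dx`. -/
def phiDeriv (f u v : ℝ → ℝ) : ℝ :=
  innerX u v / (2 * π) - ∫ x in Ioo (0 : ℝ) 1, f (u x) * v x

/-- The Palais–Smale condition at level `c`. -/
def PalaisSmaleAt (f : ℝ → ℝ) (c : ℝ) : Prop :=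
  ∀ u : ℕ → ℝ → ℝ, (∀ n, memX (u n)) →
    Filter.Tendsto (fun n => phi f (u n)) Filter.atTop (𝓝 c) →
    (∃ ε : ℕ → ℝ, Filter.Tendsto ε Filter.atTop (𝓝 0) ∧
      ∀ n, ∀ v : ℝ → ℝ, memX v → gagNorm v ≤ 1 → |phiDeriv f (u n) v| ≤ ε n) →
    ∃ w : ℝ → ℝ, memX w ∧ ∃ g : ℕ → ℕ, StrictMono g ∧
      Filter.Tendsto (fun k => gagNorm (fun x => u (g k) x - w x)) Filter.atTop (𝓝 0)




theorem ekeland_aux {E : Type*} [MetricSpace E] [CompleteSpace E] (Φ : E → ℝ)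
    (hΦ : LowerSemicontinuous Φ) (m : ℝ) (hm : ∀ x, m ≤ Φ x) (ε : ℝ) (hε : 0 < ε) (x0 : E) :
    ∃ x, Φ x ≤ Φ x0 ∧ ∀ y, Φ x ≤ Φ y + ε * dist x y := by
  let S : E → Set E := fun x => {y | Φ y + ε * dist x y ≤ Φ x}
  have hself : ∀ x, x ∈ S x := fun x => by simp [S]
  have htrans : ∀ x y z, y ∈ S x → z ∈ S y → z ∈ S x := by
    intro x y z hy hz
    simp only [S, mem_ofPred_eq] at *
    have := dist_triangle x y z
    nlinarith
  have hclosed : ∀ x, IsClosed (S x) := by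
    intro x
    have : LowerSemicontinuous (fun y => Φ y + ε * dist x y) :=
      hΦ.add (Continuous.lowerSemicontinuous (by fun_prop))
    exact this.isClosed_preimage (Φ x)
  have hchoice : ∀ (n : ℕ) (x : E), ∃ y ∈ S x, ∀ z ∈ S x, Φ y ≤ Φ z + (1/2:ℝ)^n := by
    intro n x
    have hbdd : BddBelow (Φ '' S x) := ⟨m, by rintro _ ⟨y, _, rfl⟩; exact hm y⟩
    have hne : (Φ '' S x).Nonempty := ⟨_, x, hself x, rfl⟩
    obtain ⟨_, ⟨y, hy, rfl⟩, hlt⟩ := exists_lt_of_csInf_lt hne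
      (lt_add_of_pos_right (sInf (Φ '' S x)) (by positivity : (0:ℝ) < (1/2)^n))
    refine ⟨y, hy, fun z hz => ?_⟩
    have := csInf_le hbdd (⟨z, hz, rfl⟩ : Φ z ∈ Φ '' S x)
    linarith
  choose next hnext1 hnext2 using hchoice
  let s : ℕ → E := fun n => Nat.rec x0 (fun k x => next k x) n
  have hs : ∀ n, s (n+1) = next n (s n) := fun n => rfl
  have hstep : ∀ n, s (n+1) ∈ S (s n) := fun n => by rw [hs]; exact hnext1 _ _
  have hmono : ∀ n k, s (n+k) ∈ S (s n) := by
    intro n k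
    induction k with
    | zero => exact hself _
    | succ k ih => exact htrans _ _ _ ih (hstep (n+k))
  have hsmall : ∀ n z, z ∈ S (s (n+1)) → dist (s (n+1)) z ≤ (1/2:ℝ)^n / ε := by
    intro n z hz
    have h1 := hnext2 n (s n) z (htrans _ _ _ (hstep n) hz)
    rw [← hs] at h1
    simp only [S, mem_ofPred_eq] at hz
    rw [le_div_iff₀ hε]
    linarith
  have h0 : Tendsto (fun n : ℕ => (1/2:ℝ)^n / ε) atTop (𝓝 0) := by
    have := (tendsto_pow_atTop_nhds_zero_of_lt_one (by norm_num : (0:ℝ) ≤ 1/2)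
      (by norm_num)).div_const ε
    simpa using this
  have hcau : CauchySeq (fun n => s (n+1)) := by
    refine cauchySeq_of_le_tendsto_0 (fun n => 2 * ((1/2:ℝ)^n / ε)) ?_ (by simpa using h0.const_mul 2)
    intro n k N hn hk
    obtain ⟨i, rfl⟩ := Nat.exists_eq_add_of_le hn
    obtain ⟨j, rfl⟩ := Nat.exists_eq_add_of_le hk
    have e1 := hsmall N (s (N+i+1)) (by have := hmono (N+1) i; rwa [show N+1+i = N+i+1 by ring] at this)
    have e2 := hsmall N (s (N+j+1)) (by have := hmono (N+1) j; rwa [show N+1+j = N+j+1 by ring] at this)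
    have := dist_triangle_left (s (N+i+1)) (s (N+j+1)) (s (N+1))
    linarith
  obtain ⟨x, hx⟩ := cauchySeq_tendsto_of_complete hcau
  have hxS : ∀ n, x ∈ S (s n) := by
    intro n
    refine (hclosed (s n)).mem_of_tendsto hx ?_
    filter_upwards [eventually_ge_atTop n] with k hk
    obtain ⟨i, rfl⟩ := Nat.exists_eq_add_of_le hk
    exact hmono n (i+1)
  refine ⟨x, ?_, ?_⟩
  · have := hxS 0
    simp only [S, mem_ofPred_eq] at this
    have h2 : 0 ≤ ε * dist (s 0) x := by positivity
    have h3 : s 0 = x0 := rfl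
    rw [h3] at this h2
    linarith
  · intro y
    by_contra! hcon
    have hy : y ∈ S x := hcon.le
    have hyn : Tendsto (fun n => s (n+1)) atTop (𝓝 y) := by
      rw [tendsto_iff_dist_tendsto_zero]
      exact squeeze_zero (fun _ => dist_nonneg) (fun n => hsmall n y (htrans _ _ _ (hxS (n+1)) hy)) h0
    have : x = y := tendsto_nhds_unique hx hyn
    subst this
    simp at hcon

theorem mountain_pass_aux {H : Type*} [NormedAddCommGroup H] [NormedSpace ℝ H] [CompleteSpace H]
    (φ : H → ℝ) (D : H → H → ℝ) (hφ : Continuous φ)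
    (hD : Continuous (fun p : H × H => D p.1 p.2))
    (hadd : ∀ u v w, D u (v + w) = D u v + D u w)
    (hsmul : ∀ u (c : ℝ) v, D u (c • v) = c * D u v)
    (hder : ∀ u v, HasDerivAt (fun s : ℝ => φ (u + s • v)) (D u v) 0)
    (e : H) (ρ a b : ℝ) (hρ0 : 0 < ρ) (hρ : ρ < ‖e‖) (h0 : φ 0 < a) (he : φ e < a)
    (hsph : ∀ u, ‖u‖ = ρ → a ≤ φ u)
    (hray : ∀ s ∈ Icc (0:ℝ) 1, φ (s • e) ≤ b) (ε : ℝ) (hε : 0 < ε) :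
    ∃ u, a - ε ≤ φ u ∧ φ u ≤ b ∧ ∀ v, |D u v| ≤ 2 * ε * ‖v‖ := by
  let G : Set C(unitInterval, H) := {γ | γ 0 = 0 ∧ γ 1 = e}
  have hGc : IsClosed G := by
    apply IsClosed.inter
    · exact isClosed_eq (continuous_eval_const (0:unitInterval)) continuous_const
    · exact isClosed_eq (continuous_eval_const (1:unitInterval)) continuous_const
  have : CompleteSpace G := hGc.completeSpace_coe
  let Φ : C(unitInterval, H) → ℝ := fun γ => ⨆ t, φ (γ t)
  have hbd : ∀ γ : C(unitInterval, H), BddAbove (range fun t => φ (γ t)) := fun γ =>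
    (isCompact_range (hφ.comp γ.continuous)).bddAbove
  have hleΦ : ∀ (γ : C(unitInterval, H)) t, φ (γ t) ≤ Φ γ := fun γ t => le_ciSup (hbd γ) t
  have hΦle : ∀ (γ : C(unitInterval, H)) x, (∀ t, φ (γ t) ≤ x) → Φ γ ≤ x := fun γ x h =>
    ciSup_le h
  have hlsc : LowerSemicontinuous (fun γ : G => Φ γ.1) := by
    apply lowerSemicontinuous_ciSup
    · intro γ; exact hbd γ.1
    · intro t
      apply Continuous.lowerSemicontinuous
      exact hφ.comp ((continuous_eval_const t).comp continuous_subtype_val)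
  have hlow : ∀ γ : G, a ≤ Φ γ.1 := by
    rintro ⟨γ, hγ0, hγ1⟩
    have hc : Continuous (fun t => ‖γ t‖) := by fun_prop
    have : ρ ∈ range (fun t => ‖γ t‖) := by
      apply mem_range_of_exists_le_of_exists_ge hc
      · exact ⟨0, by simp [hγ0, hρ0.le]⟩
      · exact ⟨1, by simp [hγ1, hρ.le]⟩
    obtain ⟨t, ht⟩ := this
    exact (hsph _ ht).trans (hleΦ γ t)
  let γ0 : G := ⟨⟨fun t => (t:ℝ) • e, by fun_prop⟩, by simp, by simp⟩
  obtain ⟨⟨γ, hγ0, hγ1⟩, hγb, hγE⟩ := ekeland_aux (fun γ : G => Φ γ.1) hlsc a hlow ε hε γ0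
  have hγb' : Φ γ ≤ b := hγb.trans (hΦle _ _ fun t => hray _ t.2)
  have hγa : a ≤ Φ γ := hlow ⟨γ, hγ0, hγ1⟩
  obtain ⟨κ, hκ0, hκε, hκ1, hκ2⟩ : ∃ κ > 0, κ ≤ ε ∧ φ 0 < a - κ ∧ φ e < a - κ := by
    refine ⟨min ε (min ((a - φ 0)/2) ((a - φ e)/2)), ?_, min_le_left _ _, ?_, ?_⟩
    · simp only [gt_iff_lt, lt_min_iff]; exact ⟨hε, by linarith, by linarith⟩
    · have : min ε (min ((a - φ 0)/2) ((a - φ e)/2)) ≤ (a - φ 0)/2 :=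
        (min_le_right _ _).trans (min_le_left _ _)
      linarith
    · have : min ε (min ((a - φ 0)/2) ((a - φ e)/2)) ≤ (a - φ e)/2 :=
        (min_le_right _ _).trans (min_le_right _ _)
      linarith
  by_contra! hcon
  -- descent directions
  have hdesc : ∀ t, Φ γ - κ ≤ φ (γ t) → ∃ v, ‖v‖ ≤ 1 ∧ D (γ t) v < - (2 * ε) := by
    intro t ht
    obtain ⟨v, hv⟩ := hcon (γ t) (by linarith) ((hleΦ γ t).trans hγb')
    have hv0 : v ≠ 0 := by
      rintro rfl
      have := hsmul (γ t) 0 0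
      simp at this
      simp [this] at hv
    have hvn : 0 < ‖v‖ := norm_pos_iff.mpr hv0
    rcases le_or_gt 0 (D (γ t) v) with h | h
    · refine ⟨(-‖v‖⁻¹) • v, ?_, ?_⟩
      · rw [norm_smul]; simp [hvn.ne']
      · rw [hsmul]
        rw [abs_of_nonneg h] at hv
        have : 2 * ε < ‖v‖⁻¹ * D (γ t) v := by
          rw [inv_mul_eq_div, lt_div_iff₀ hvn]; exact hv
        linarith
    · refine ⟨(‖v‖⁻¹) • v, ?_, ?_⟩
      · rw [norm_smul]; simp [hvn.ne']
      · rw [hsmul]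
        rw [abs_of_neg h] at hv
        have : 2 * ε < ‖v‖⁻¹ * (- D (γ t) v) := by
          rw [inv_mul_eq_div, lt_div_iff₀ hvn]; exact hv
        linarith
  have hφγ : Continuous (fun t => φ (γ t)) := hφ.comp γ.continuous
  obtain ⟨w, hw⟩ := exists_continuous_forall_mem_convex_of_local_const
    (t := fun t : unitInterval => {v : H | ‖v‖ ≤ 1 ∧ (Φ γ - κ ≤ φ (γ t) → D (γ t) v < - (2*ε))
      ∧ (t ∈ ({0, 1} : Set unitInterval) → v = 0)}) (by
      intro t x hx y hy p q hp hq hpq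
      obtain ⟨hx1, hx2, hx3⟩ := hx
      obtain ⟨hy1, hy2, hy3⟩ := hy
      refine ⟨?_, ?_, ?_⟩
      · calc ‖p • x + q • y‖ ≤ ‖p • x‖ + ‖q • y‖ := norm_add_le _ _
          _ = p * ‖x‖ + q * ‖y‖ := by rw [norm_smul, norm_smul, norm_of_nonneg hp, norm_of_nonneg hq]
          _ ≤ 1 := by nlinarith
      · intro h
        rw [hadd, hsmul, hsmul]
        have := hx2 h; have := hy2 h
        have hq' : q = 1 - p := by linarith
        subst hq'
        rcases hp.eq_or_lt with h0 | h0
        · subst h0; simp; linarith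
        · nlinarith
      · intro h; rw [hx3 h, hy3 h]; simp) (by
      intro t
      by_cases ht : Φ γ - κ ≤ φ (γ t)
      · obtain ⟨v, hv1, hv2⟩ := hdesc t ht
        refine ⟨v, ?_⟩
        have c1 : Continuous (fun t => D (γ t) v) := hD.comp (γ.continuous.prodMk continuous_const)
        have ht2 : t ∈ ({0, 1} : Set unitInterval)ᶜ := by
          rintro (h | h)
          · rw [h, hγ0] at ht; linarith
          · rw [h, hγ1] at ht; linarith
        have hnb : ({0, 1} : Set unitInterval)ᶜ ∈ 𝓝 t :=
          (Set.toFinite _).isClosed.isOpen_compl.mem_nhds ht2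
        filter_upwards [c1.continuousAt.eventually_lt continuousAt_const hv2, hnb] with y hy1 hy2
        exact ⟨hv1, fun _ => hy1, fun h => absurd h hy2⟩
      · refine ⟨0, ?_⟩
        push Not at ht
        filter_upwards [hφγ.continuousAt.eventually_lt continuousAt_const ht] with y hy
        exact ⟨by simp, fun h => absurd h (not_le.mpr hy), fun _ => rfl⟩)
  have hw1 : ∀ t, ‖w t‖ ≤ 1 := fun t => (hw t).1
  have c0 : Continuous (fun p : ℝ × unitInterval => γ p.2 + p.1 • w p.2) := by fun_prop
  have c1 : Continuous (fun p : ℝ × unitInterval => D (γ p.2 + p.1 • w p.2) (w p.2)) :=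
    hD.comp (c0.prodMk (w.continuous.comp continuous_snd))
  have c2 : Continuous (fun p : ℝ × unitInterval => φ (γ p.2 + p.1 • w p.2)) := hφ.comp c0
  have ev1 : ∀ᶠ s : ℝ in 𝓝 0, ∀ t ∈ (univ : Set unitInterval),
      (φ (γ t) < Φ γ - κ ∨ D (γ t + s • w t) (w t) < - (3/2 * ε)) := by
    apply isCompact_univ.eventually_forall_of_forall_eventually
    intro t _
    by_cases ht : Φ γ - κ ≤ φ (γ t)
    · have h2 : D (γ t + (0:ℝ) • w t) (w t) < - (3/2 * ε) := by
        have := (hw t).2.1 ht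
        simp only [zero_smul, add_zero]; linarith
      have := (c1.continuousAt (x := ((0:ℝ), t))).eventually_lt continuousAt_const h2
      filter_upwards [this] with p hp
      exact Or.inr hp
    · push Not at ht
      have c3 : Continuous (fun p : ℝ × unitInterval => φ (γ p.2)) := hφγ.comp continuous_snd
      have := (c3.continuousAt (x := ((0:ℝ), t))).eventually_lt continuousAt_const ht
      filter_upwards [this] with p hp
      exact Or.inl hp
  have ev2 : ∀ᶠ s : ℝ in 𝓝 0, ∀ t ∈ (univ : Set unitInterval),
      φ (γ t + s • w t) < φ (γ t) + κ / 2 := by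
    apply isCompact_univ.eventually_forall_of_forall_eventually
    intro t _
    have c3 : Continuous (fun p : ℝ × unitInterval => φ (γ p.2) + κ/2) :=
      (hφγ.comp continuous_snd).add continuous_const
    exact (c2.continuousAt (x := ((0:ℝ), t))).eventually_lt c3.continuousAt (by simp; linarith)
  obtain ⟨δ, hδ0, hδ⟩ := Metric.eventually_nhds_iff.mp (ev1.and ev2)
  obtain ⟨h, hh0, hhδ, hhκ⟩ : ∃ h > 0, h < δ ∧ ε * h < κ / 4 := by
    refine ⟨min (δ/2) (κ/(8*ε)), by positivity, ?_, ?_⟩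
    · exact (min_le_left _ _).trans_lt (by linarith)
    · calc ε * min (δ/2) (κ/(8*ε)) ≤ ε * (κ/(8*ε)) := by gcongr; exact min_le_right _ _
        _ = κ / 8 := by field_simp
        _ < κ / 4 := by linarith
  have hmv : ∀ t, Φ γ - κ ≤ φ (γ t) → φ (γ t + h • w t) ≤ φ (γ t) - 3/2 * ε * h := by
    intro t ht
    have hd : ∀ s : ℝ, HasDerivAt (fun s : ℝ => φ (γ t + s • w t)) (D (γ t + s • w t) (w t)) s := by
      intro s
      have h1 := hder (γ t + s • w t) (w t)
      have h2 : HasDerivAt (fun r : ℝ => r - s) 1 s := by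
        simpa using (hasDerivAt_id s).sub_const s
      have h1' : HasDerivAt (fun r : ℝ => φ (γ t + s • w t + r • w t)) (D (γ t + s • w t) (w t)) (s - s) := by
        rw [sub_self]; exact h1
      have h3 := HasDerivAt.comp (h := fun r : ℝ => r - s) s h1' h2
      rw [mul_one] at h3
      refine h3.congr_of_eventuallyEq (Eventually.of_forall fun r => ?_)
      simp only [Function.comp]
      congr 1
      rw [add_assoc, ← add_smul]; congr 2; ring
    have hc : ContinuousOn (fun s : ℝ => φ (γ t + s • w t)) (Icc 0 h) :=
      fun s _ => (hd s).continuousAt.continuousWithinAt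
    obtain ⟨s, hs, hseq⟩ := exists_hasDerivAt_eq_slope (fun s : ℝ => φ (γ t + s • w t))
      (fun s => D (γ t + s • w t) (w t)) hh0 hc (fun s _ => hd s)
    have hb := (hδ (y := s) (by
      rw [Real.dist_eq, sub_zero, abs_of_pos hs.1]; exact hs.2.trans hhδ)).1 t (mem_univ t)
    rcases hb with hb | hb
    · linarith
    · rw [hseq, div_lt_iff₀ (by linarith)] at hb
      simp only [zero_smul, add_zero, sub_zero] at hb
      linarith
  let η : C(unitInterval, H) := ⟨fun t => γ t + h • w t, by fun_prop⟩
  have hη0 : η 0 = 0 := by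
    have := (hw 0).2.2 (by simp)
    simp [η, hγ0, this]
  have hη1 : η 1 = e := by
    have := (hw 1).2.2 (by simp)
    simp [η, hγ1, this]
  have hE := hγE ⟨η, hη0, hη1⟩
  have hdist : dist (⟨γ, hγ0, hγ1⟩ : G) ⟨η, hη0, hη1⟩ ≤ h := by
    rw [Subtype.dist_eq, ContinuousMap.dist_le hh0.le]
    intro t
    simp only [η, ContinuousMap.coe_mk, dist_self_add_right, norm_smul, norm_of_nonneg hh0.le]
    nlinarith [hw1 t]
  have hΦη : Φ η < Φ γ - ε * h := by
    have : Φ η ≤ max (Φ γ - 3/2 * ε * h) (Φ γ - κ/2) := by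
      apply hΦle
      intro t
      by_cases ht : Φ γ - κ ≤ φ (γ t)
      · apply le_max_of_le_left
        have := hmv t ht
        have := hleΦ γ t
        simp only [η, ContinuousMap.coe_mk]; linarith
      · apply le_max_of_le_right
        push Not at ht
        have := (hδ (y := h) (by rw [Real.dist_eq, sub_zero, abs_of_pos hh0]; exact hhδ)).2 t (mem_univ t)
        simp only [η, ContinuousMap.coe_mk]; linarith
    refine this.trans_lt (max_lt ?_ ?_)
    · nlinarith [mul_pos hε hh0]
    · linarith
  simp only at hE
  nlinarith

theorem weak_seq_aux {H : Type*} [NormedAddCommGroup H] [InnerProductSpace ℝ H] [CompleteSpace H]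
    [TopologicalSpace.SeparableSpace H] (u : ℕ → H) (R : ℝ) (hu : ∀ n, ‖u n‖ ≤ R) :
    ∃ w : H, ∃ g : ℕ → ℕ, StrictMono g ∧
      ∀ z : H, Tendsto (fun k => inner ℝ (u (g k)) z) atTop (𝓝 (inner ℝ w z)) := by
  have hc := WeakDual.isSeqCompact_closedBall ℝ H (0 : StrongDual ℝ H) R
  obtain ⟨a, ha, g, hg, hlim⟩ := hc (x := fun n => StrongDual.toWeakDual (InnerProductSpace.toDual ℝ H (u n)))
    (fun n => by simp [hu n])
  refine ⟨(InnerProductSpace.toDual ℝ H).symm (WeakDual.toStrongDual a), g, hg, fun z => ?_⟩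
  have := (WeakDual.eval_continuous (𝕜 := ℝ) (E := H) z).tendsto a |>.comp hlim
  simp only [InnerProductSpace.toDual_symm_apply]
  exact this



def dq (u : ℝ → ℝ) (p : ℝ × ℝ) : ℝ := (u p.1 - u p.2) / (p.1 - p.2)

theorem gagKer_eq (u : ℝ → ℝ) : gagKer u = fun p => (dq u p) ^ 2 := by
  funext p; simp only [gagKer, dq, div_pow, sq_abs]

theorem innerKer_eq (u v : ℝ → ℝ) : innerKer u v = fun p => dq u p * dq v p := by
  funext p; simp only [innerKer, dq, sq_abs]; rw [div_mul_div_comm, sq]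

theorem dq_meas {u : ℝ → ℝ} (hu : Measurable u) : Measurable (dq u) := by
  unfold dq; fun_prop

theorem memX_iff (u : ℝ → ℝ) : memX u ↔ Measurable u ∧ MemLp u 2 volume ∧ MemLp (dq u) 2 volume ∧
    ∀ᵐ x : ℝ, x ∉ Ioo (0 : ℝ) 1 → u x = 0 := by
  unfold memX memH
  rw [gagKer_eq]
  constructor
  · rintro ⟨⟨h1, h2, h3⟩, h4⟩
    exact ⟨h1, (memLp_two_iff_integrable_sq h1.aestronglyMeasurable).2 h2,
      (memLp_two_iff_integrable_sq (dq_meas h1).aestronglyMeasurable).2 h3, h4⟩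
  · rintro ⟨h1, h2, h3, h4⟩
    exact ⟨⟨h1, (memLp_two_iff_integrable_sq h1.aestronglyMeasurable).1 h2,
      (memLp_two_iff_integrable_sq (dq_meas h1).aestronglyMeasurable).1 h3⟩, h4⟩

theorem memX.meas {u : ℝ → ℝ} (h : memX u) : Measurable u := h.1.1
theorem memX.lp {u : ℝ → ℝ} (h : memX u) : MemLp u 2 volume := ((memX_iff u).1 h).2.1
theorem memX.dlp {u : ℝ → ℝ} (h : memX u) : MemLp (dq u) 2 volume := ((memX_iff u).1 h).2.2.1

theorem dq_add (u v : ℝ → ℝ) : dq (fun x => u x + v x) = dq u + dq v := by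
  funext p; simp only [dq, Pi.add_apply]; ring
theorem dq_sub (u v : ℝ → ℝ) : dq (fun x => u x - v x) = dq u - dq v := by
  funext p; simp only [dq, Pi.sub_apply]; ring
theorem dq_smul (c : ℝ) (u : ℝ → ℝ) : dq (fun x => c * u x) = c • dq u := by
  funext p; simp only [dq, Pi.smul_apply, smul_eq_mul]; ring

theorem memX_add {u v : ℝ → ℝ} (hu : memX u) (hv : memX v) : memX (fun x => u x + v x) := by
  rw [memX_iff]
  refine ⟨hu.meas.add hv.meas, hu.lp.add hv.lp, ?_, ?_⟩
  · rw [dq_add]; exact hu.dlp.add hv.dlp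
  · filter_upwards [hu.2, hv.2] with x h1 h2 h3
    rw [h1 h3, h2 h3, add_zero]

theorem memX_smul (c : ℝ) {u : ℝ → ℝ} (hu : memX u) : memX (fun x => c * u x) := by
  rw [memX_iff]
  refine ⟨hu.meas.const_mul c, hu.lp.const_mul c, ?_, ?_⟩
  · rw [dq_smul]; exact hu.dlp.const_smul c
  · filter_upwards [hu.2] with x h1 h3
    rw [h1 h3, mul_zero]

theorem memX_sub {u v : ℝ → ℝ} (hu : memX u) (hv : memX v) : memX (fun x => u x - v x) := by
  have := memX_add hu (memX_smul (-1) hv)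
  simpa [sub_eq_add_neg] using this

theorem memX_zero : memX (fun _ => 0) := by
  rw [memX_iff]
  refine ⟨measurable_const, MemLp.zero, ?_, by simp⟩
  have : dq (fun _ => 0) = 0 := by funext p; simp [dq]
  rw [this]; exact MemLp.zero

theorem gagSq_nonneg (u : ℝ → ℝ) : 0 ≤ gagSq u := by
  unfold gagSq; rw [gagKer_eq]; positivity

theorem gagSq_smul (c : ℝ) (u : ℝ → ℝ) : gagSq (fun x => c * u x) = c ^ 2 * gagSq u := by
  unfold gagSq
  rw [gagKer_eq, gagKer_eq, dq_smul, ← integral_const_mul]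
  congr 1; funext p; simp; ring

theorem poincare {u : ℝ → ℝ} (hu : memX u) :
    lam1 * (∫ x in Ioo (0:ℝ) 1, (u x)^2) ≤ gagSq u := by
  set s := ∫ x in Ioo (0:ℝ) 1, (u x)^2 with hs
  have hs0 : 0 ≤ s := by positivity
  rcases hs0.eq_or_lt with h | h
  · rw [← h, mul_zero]; exact gagSq_nonneg u
  · have h1 : lam1 ≤ gagSq (fun x => (√s)⁻¹ * u x) := by
      apply csInf_le
      · refine ⟨0, ?_⟩
        rintro _ ⟨u, _, _, rfl⟩
        exact gagSq_nonneg u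
      · refine ⟨_, memX_smul _ hu, ?_, rfl⟩
        simp only [mul_pow]
        rw [integral_const_mul, ← hs, inv_pow, sq_sqrt hs0, inv_mul_cancel₀ h.ne']
    rw [gagSq_smul, inv_pow, sq_sqrt hs0, inv_mul_eq_div, le_div_iff₀ h] at h1
    exact h1

theorem int_full {u : ℝ → ℝ} (hu : memX u) :
    ∫ x, (u x)^2 = ∫ x in Ioo (0:ℝ) 1, (u x)^2 := by
  rw [← integral_indicator measurableSet_Ioo]
  apply integral_congr_ae
  filter_upwards [hu.2] with x hx
  by_cases h : x ∈ Ioo (0:ℝ) 1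
  · simp [h]
  · simp [h, hx h]

theorem eq_zero_of_gagSq (hl1 : 0 < lam1) {u : ℝ → ℝ} (hu : memX u) (h : gagSq u = 0) :
    u =ᵐ[volume] fun _ => 0 := by
  have h1 := poincare hu
  rw [h, ← int_full hu] at h1
  have h2 : 0 ≤ ∫ x, (u x)^2 := by positivity
  have h3 : ∫ x, (u x)^2 = 0 := by nlinarith
  rw [integral_eq_zero_iff_of_nonneg (fun x => by positivity) hu.1.2.1] at h3
  filter_upwards [h3] with x hx
  simpa using hx

theorem gagSq_eq_of_dq_zero {u : ℝ → ℝ} (h : dq u =ᵐ[volume] 0) : gagSq u = 0 := by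
  unfold gagSq
  rw [gagKer_eq]
  rw [integral_congr_ae (g := fun _ => 0)]
  · simp
  · filter_upwards [h] with p hp
    simp [hp]

abbrev L2 := Lp ℝ 2 (volume : Measure (ℝ × ℝ))

def HX : Submodule ℝ L2 where
  carrier := {g | ∃ u, memX u ∧ g =ᵐ[volume] dq u}
  add_mem' := by
    rintro g h ⟨u, hu, hgu⟩ ⟨v, hv, hhv⟩
    refine ⟨_, memX_add hu hv, ?_⟩
    rw [dq_add]
    exact (Lp.coeFn_add g h).trans (hgu.add hhv)
  zero_mem' := by
    refine ⟨_, memX_zero, ?_⟩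
    have : dq (fun _ => 0) = 0 := by funext p; simp [dq]
    rw [this]; exact Lp.coeFn_zero ..
  smul_mem' := by
    rintro c g ⟨u, hu, hgu⟩
    refine ⟨_, memX_smul c hu, ?_⟩
    rw [dq_smul]
    exact (Lp.coeFn_smul c g).trans (hgu.const_smul c)

def rep (g : HX) : ℝ → ℝ := g.2.choose

theorem rep_mem (g : HX) : memX (rep g) := g.2.choose_spec.1
theorem rep_spec (g : HX) : (g : L2) =ᵐ[volume] dq (rep g) := g.2.choose_spec.2

theorem rep_unique (hl1 : 0 < lam1) (g : HX) {u : ℝ → ℝ} (hu : memX u)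
    (h : (g : L2) =ᵐ[volume] dq u) : rep g =ᵐ[volume] u := by
  have h1 := memX_sub (rep_mem g) hu
  have h2 : dq (fun x => rep g x - u x) =ᵐ[volume] 0 := by
    rw [dq_sub]
    filter_upwards [rep_spec g, h] with p h3 h4
    simp [← h3, ← h4]
  have h3 := eq_zero_of_gagSq hl1 h1 (gagSq_eq_of_dq_zero h2)
  filter_upwards [h3] with x hx
  linarith

def toHX (u : ℝ → ℝ) (hu : memX u) : HX := ⟨hu.dlp.toLp _, u, hu, hu.dlp.coeFn_toLp⟩

theorem toHX_spec (u : ℝ → ℝ) (hu : memX u) : (toHX u hu : L2) =ᵐ[volume] dq u := hu.dlp.coeFn_toLp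

theorem rep_toHX (hl1 : 0 < lam1) (u : ℝ → ℝ) (hu : memX u) : rep (toHX u hu) =ᵐ[volume] u :=
  rep_unique hl1 _ hu (toHX_spec u hu)

theorem rep_add (hl1 : 0 < lam1) (g h : HX) : rep (g + h) =ᵐ[volume] fun x => rep g x + rep h x := by
  apply rep_unique hl1 _ (memX_add (rep_mem g) (rep_mem h))
  rw [dq_add]
  exact (Lp.coeFn_add (g : L2) h).trans ((rep_spec g).add (rep_spec h))

theorem rep_smul (hl1 : 0 < lam1) (c : ℝ) (g : HX) : rep (c • g) =ᵐ[volume] fun x => c * rep g x := by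
  apply rep_unique hl1 _ (memX_smul c (rep_mem g))
  rw [dq_smul]
  exact (Lp.coeFn_smul c (g : L2)).trans ((rep_spec g).const_smul c)

theorem rep_sub (hl1 : 0 < lam1) (g h : HX) : rep (g - h) =ᵐ[volume] fun x => rep g x - rep h x := by
  apply rep_unique hl1 _ (memX_sub (rep_mem g) (rep_mem h))
  rw [dq_sub]
  exact (Lp.coeFn_sub (g : L2) h).trans ((rep_spec g).sub (rep_spec h))

theorem rep_zero (hl1 : 0 < lam1) : rep 0 =ᵐ[volume] fun _ => 0 := by
  apply rep_unique hl1 _ memX_zero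
  have : dq (fun _ => 0) = 0 := by funext p; simp [dq]
  rw [this]; exact Lp.coeFn_zero ..

theorem inner_eq_of (g h : HX) {u v : ℝ → ℝ} (hu : (g : L2) =ᵐ[volume] dq u)
    (hv : (h : L2) =ᵐ[volume] dq v) : inner ℝ g h = innerX u v := by
  change inner ℝ (g : L2) (h : L2) = _
  rw [L2.inner_def]
  unfold innerX
  rw [innerKer_eq]
  apply integral_congr_ae
  filter_upwards [hu, hv] with p h1 h2
  rw [h1, h2]; simp [mul_comm]

theorem normsq_eq_of (g : HX) {u : ℝ → ℝ} (hu : (g : L2) =ᵐ[volume] dq u) : ‖g‖^2 = gagSq u := by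
  rw [← real_inner_self_eq_norm_sq, inner_eq_of g g hu hu]
  unfold innerX gagSq
  rw [innerKer_eq, gagKer_eq]
  simp only [sq]

theorem normsq_rep (g : HX) : ‖g‖^2 = gagSq (rep g) := normsq_eq_of g (rep_spec g)

theorem gagSq_congr_of (g : HX) {u : ℝ → ℝ} (hu : (g : L2) =ᵐ[volume] dq u) :
    gagNorm u = ‖g‖ := by
  unfold gagNorm; rw [← normsq_eq_of g hu, sqrt_sq (norm_nonneg _)]

theorem dq_ae_congr {u v : ℝ → ℝ} (h : u =ᵐ[volume] v) : dq u =ᵐ[volume] dq v := by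
  have h1 : ∀ᵐ p : ℝ × ℝ, u p.1 = v p.1 := Measure.quasiMeasurePreserving_fst.ae h
  have h2 : ∀ᵐ p : ℝ × ℝ, u p.2 = v p.2 := Measure.quasiMeasurePreserving_snd.ae h
  filter_upwards [h1, h2] with p e1 e2
  simp [dq, e1, e2]

theorem rep_l2 (hl1 : 0 < lam1) (g : HX) : ∫ x in Ioo (0:ℝ) 1, (rep g x)^2 ≤ ‖g‖^2 / lam1 := by
  rw [le_div_iff₀ hl1, normsq_rep, mul_comm]; exact poincare (rep_mem g)

theorem HX_closed (hl1 : 0 < lam1) : IsClosed (HX : Set L2) := by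
  apply IsSeqClosed.isClosed
  intro g G hg hG
  choose u hu hgu using hg
  let U : ℕ → Lp ℝ 2 (volume : Measure ℝ) := fun n => (hu n).lp.toLp _
  have hdist : ∀ n m, dist (U n) (U m) ≤ (√lam1)⁻¹ * dist (g n) (g m) := by
    intro n m
    have hs := memX_sub (hu n) (hu m)
    have e1 : dist (g n) (g m) = √ (gagSq (fun x => u n x - u m x)) := by
      have hq : (g n - g m : L2) =ᵐ[volume] dq (fun x => u n x - u m x) := by
        rw [dq_sub]; exact (Lp.coeFn_sub _ _).trans ((hgu n).sub (hgu m))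
      have := gagSq_congr_of (⟨g n - g m, _, hs, hq⟩ : HX) hq
      unfold gagNorm at this
      rw [this, dist_eq_norm]; rfl
    have e2 : dist (U n) (U m) ^ 2 = ∫ x, (u n x - u m x)^2 := by
      rw [dist_eq_norm, ← real_inner_self_eq_norm_sq, L2.inner_def]
      apply integral_congr_ae
      filter_upwards [Lp.coeFn_sub (U n) (U m), (hu n).lp.coeFn_toLp, (hu m).lp.coeFn_toLp] with x h1 h2 h3
      have h2' : U n x = u n x := h2
      have h3' : U m x = u m x := h3
      rw [h1, Pi.sub_apply, h2', h3']; simp [sq]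
    have e3 := poincare hs
    rw [← int_full hs, ← e2] at e3
    rw [e1, inv_mul_eq_div, le_div_iff₀ (sqrt_pos.2 hl1)]
    apply le_sqrt_of_sq_le
    rw [mul_pow, sq_sqrt hl1.le]; linarith
  have hcau : CauchySeq U := by
    have hc := hG.cauchySeq
    rw [Metric.cauchySeq_iff] at hc ⊢
    intro ε hε
    have hl := sqrt_pos.2 hl1
    obtain ⟨N, hN⟩ := hc (√lam1 * ε) (by positivity)
    refine ⟨N, fun m hm n hn => (hdist m n).trans_lt ?_⟩
    rw [inv_mul_lt_iff₀ hl]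
    exact hN m hm n hn
  obtain ⟨V, hV⟩ := cauchySeq_tendsto_of_complete hcau
  obtain ⟨ns, hns, hae⟩ := (tendstoInMeasure_of_tendsto_Lp hV).exists_seq_tendsto_ae
  have hG' : Tendsto (fun n => g (ns n)) atTop (𝓝 G) := hG.comp hns.tendsto_atTop
  obtain ⟨ms, hms, hae2⟩ := (tendstoInMeasure_of_tendsto_Lp hG').exists_seq_tendsto_ae
  have hvm : Measurable V := (Lp.stronglyMeasurable V).measurable
  have hcv : ∀ᵐ x, Tendsto (fun k => u (ns (ms k)) x) atTop (𝓝 (V x)) := by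
    have : ∀ᵐ x, ∀ n, U n x = u n x := ae_all_iff.2 fun n => (hu n).lp.coeFn_toLp
    filter_upwards [hae, this] with x h1 h2
    have := h1.comp hms.tendsto_atTop
    simpa [Function.comp_def, h2] using this
  have hGd : G =ᵐ[volume] dq V := by
    have h1 : ∀ᵐ p : ℝ × ℝ, Tendsto (fun k => u (ns (ms k)) p.1) atTop (𝓝 (V p.1)) :=
      Measure.quasiMeasurePreserving_fst.ae hcv
    have h2 : ∀ᵐ p : ℝ × ℝ, Tendsto (fun k => u (ns (ms k)) p.2) atTop (𝓝 (V p.2)) :=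
      Measure.quasiMeasurePreserving_snd.ae hcv
    have h3 : ∀ᵐ p : ℝ × ℝ, ∀ n, g n p = dq (u n) p := ae_all_iff.2 hgu
    filter_upwards [h1, h2, h3, hae2] with p e1 e2 e3 e4
    refine tendsto_nhds_unique e4 ?_
    simp only [e3]
    exact (e1.sub e2).div_const _
  refine ⟨V, ?_, hGd⟩
  rw [memX_iff]
  refine ⟨hvm, Lp.memLp V, (memLp_congr_ae hGd).1 (Lp.memLp G), ?_⟩
  have h3 : ∀ᵐ x, ∀ n, x ∉ Ioo (0:ℝ) 1 → u n x = 0 := ae_all_iff.2 fun n => (hu n).2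
  filter_upwards [hcv, h3] with x e1 e2 hx
  refine tendsto_nhds_unique e1 ?_
  simp [e2 _ hx]

theorem HX_complete (hl1 : 0 < lam1) : CompleteSpace HX := (HX_closed hl1).completeSpace_coe

instance : TopologicalSpace.SeparableSpace HX := by
  have : Fact ((2:ENNReal) ≠ ⊤) := ⟨by norm_num⟩
  have : SecondCountableTopology L2 := inferInstance
  infer_instance



theorem int_id {w : ℝ → ℝ} (hw : MemLp w 2 volume) (a h : ℝ) (hh : 0 < h) :
    Integrable (fun p : ℝ × ℝ => (w p.1 - w p.2)^2)
      ((volume.restrict (Ioc a (a+h))).prod (volume.restrict (Ioc a (a+h)))) ∧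
    ∫ p, (w p.1 - w p.2)^2 ∂((volume.restrict (Ioc a (a+h))).prod (volume.restrict (Ioc a (a+h)))) =
      2 * h * (∫ x in Ioc a (a+h), (w x)^2) - 2 * (∫ x in Ioc a (a+h), w x)^2 := by
  set ν := volume.restrict (Ioc a (a+h)) with hν
  have hw' : MemLp w 2 ν := hw.restrict _
  have hi2 : Integrable (fun x => (w x)^2) ν := hw'.integrable_sq
  have hi1 : Integrable w ν := hw'.integrable (by norm_num)
  have hc : Integrable (fun _ : ℝ => (1:ℝ)) ν := integrable_const _
  have hone : ∫ _ : ℝ, (1:ℝ) ∂ν = h := by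
    simp [hν, Measure.real, hh.le]
  have i1 := hi2.mul_prod hc
  have i2 := hc.mul_prod hi2
  have i3 := hi1.mul_prod hi1
  have e : (fun p : ℝ × ℝ => (w p.1 - w p.2)^2) =
      fun p => ((w p.1)^2 * 1 + 1 * (w p.2)^2) - 2 * (w p.1 * w p.2) := by
    funext p; ring
  constructor
  · rw [e]; exact (i1.add i2).sub (i3.const_mul 2)
  · have i12 : Integrable (fun p : ℝ × ℝ => (w p.1)^2 * 1 + 1 * (w p.2)^2) (ν.prod ν) := i1.add i2
    rw [e, integral_sub i12 (i3.const_mul 2), integral_add i1 i2, integral_const_mul 2,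
      integral_prod_mul (μ := ν) (ν := ν) (fun x => (w x)^2) (fun _ => 1),
      integral_prod_mul (μ := ν) (ν := ν) (fun _ => 1) (fun x => (w x)^2),
      integral_prod_mul (μ := ν) (ν := ν) w w, hone]
    ring

theorem cs_int {w : ℝ → ℝ} (hw : MemLp w 2 volume) (a h : ℝ) (hh : 0 < h) :
    (∫ x in Ioc a (a+h), w x)^2 ≤ h * (∫ x in Ioc a (a+h), (w x)^2) := by
  have h1 := (int_id hw a h hh).2
  have h2 : 0 ≤ ∫ p, (w p.1 - w p.2)^2 ∂((volume.restrict (Ioc a (a+h))).prod (volume.restrict (Ioc a (a+h)))) := by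
    positivity
  linarith

theorem int_est {w : ℝ → ℝ} (hw : memX w) (a h : ℝ) (hh : 0 < h) :
    ∫ x in Ioc a (a+h), (w x)^2 ≤ h⁻¹ * (∫ x in Ioc a (a+h), w x)^2
      + h * ∫ p in Ioc a (a+h) ×ˢ Ioc a (a+h), gagKer w p := by
  obtain ⟨h0, h1⟩ := int_id hw.lp a h hh
  rw [Measure.prod_restrict, ← Measure.volume_eq_prod] at h0 h1
  have hg : IntegrableOn (gagKer w) (Ioc a (a+h) ×ˢ Ioc a (a+h)) := hw.1.2.2.integrableOn
  have h2 : ∫ p in Ioc a (a+h) ×ˢ Ioc a (a+h), (w p.1 - w p.2)^2 ≤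
      ∫ p in Ioc a (a+h) ×ˢ Ioc a (a+h), h^2 * gagKer w p := by
    apply setIntegral_mono_on h0 (hg.const_mul _) (measurableSet_Ioc.prod measurableSet_Ioc)
    rintro ⟨x, y⟩ ⟨hx, hy⟩
    simp only [gagKer]
    by_cases hxy : x = y
    · simp [hxy]
    · have hpos : 0 < |x - y| := abs_pos.2 (sub_ne_zero.2 hxy)
      have hle : |x - y| ≤ h := by
        rw [abs_le]; simp only [mem_Ioc] at hx hy; constructor <;> linarith
      rw [← mul_div_assoc, le_div_iff₀ (by positivity), mul_comm]
      gcongr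
  rw [h1, integral_const_mul] at h2
  have hgn : 0 ≤ ∫ p in Ioc a (a+h) ×ˢ Ioc a (a+h), gagKer w p := by
    rw [gagKer_eq]; positivity
  set A := ∫ x in Ioc a (a+h), (w x)^2
  set B := (∫ x in Ioc a (a+h), w x)^2
  set C := ∫ p in Ioc a (a+h) ×ˢ Ioc a (a+h), gagKer w p
  have : h * A ≤ B + h^2 * C := by nlinarith [mul_nonneg (sq_nonneg h) hgn]
  calc A = h⁻¹ * (h * A) := by field_simp
    _ ≤ h⁻¹ * (B + h^2 * C) := by gcongr
    _ = h⁻¹ * B + h * C := by field_simp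

theorem rellich_est {w : ℝ → ℝ} (hw : memX w) (N : ℕ) (hN : 0 < N) :
    ∫ x in Ioo (0:ℝ) 1, (w x)^2 ≤
      N * (∑ i ∈ Finset.range N, (∫ x in Ioc ((i:ℝ)/N) ((i:ℝ)/N + 1/N), w x)^2) + 1/N * gagSq w := by
  have hN' : (0:ℝ) < N := by exact_mod_cast hN
  have hstep : ∀ i : ℕ, ((i+1 : ℕ):ℝ)/N = (i:ℝ)/N + 1/N := by intro i; push_cast; ring
  have hi : Integrable (fun x => (w x)^2) := hw.1.2.1
  have e1 : ∫ x in Ioo (0:ℝ) 1, (w x)^2 =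
      ∑ i ∈ Finset.range N, ∫ x in Ioc ((i:ℝ)/N) ((i:ℝ)/N + 1/N), (w x)^2 := by
    have := intervalIntegral.sum_integral_adjacent_intervals (f := fun x => (w x)^2)
      (μ := volume) (a := fun i : ℕ => (i:ℝ)/N) (n := N)
      (fun k _ => hi.intervalIntegrable)
    rw [← integral_Ioc_eq_integral_Ioo, ← intervalIntegral.integral_of_le zero_le_one]
    rw [show ((0:ℕ):ℝ)/N = 0 by simp, show (N:ℝ)/N = 1 by field_simp] at this
    rw [← this]
    apply Finset.sum_congr rfl
    intro i _
    rw [hstep, intervalIntegral.integral_of_le (by linarith [show (0:ℝ) < 1/N by positivity])]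
  have e2 : ∑ i ∈ Finset.range N, ∫ p in Ioc ((i:ℝ)/N) ((i:ℝ)/N + 1/N) ×ˢ Ioc ((i:ℝ)/N) ((i:ℝ)/N + 1/N), gagKer w p ≤ gagSq w := by
    rw [← integral_biUnion_finset]
    · apply setIntegral_le_integral hw.1.2.2
      rw [gagKer_eq]; exact Eventually.of_forall fun p => by simp only [Pi.zero_apply]; positivity
    · intro i _; exact measurableSet_Ioc.prod measurableSet_Ioc
    · intro i _ j _ hij
      have hm : Monotone (fun i : ℕ => (i:ℝ)/N) := fun a b hab => by
        dsimp only; gcongr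
      have := hm.pairwise_disjoint_on_Ioc_succ hij
      simp only [Function.onFun, Order.succ_eq_add_one, hstep] at this ⊢
      exact Set.disjoint_prod.2 (Or.inl this)
    · intro i _; exact hw.1.2.2.integrableOn
  rw [e1]
  calc _ ≤ ∑ i ∈ Finset.range N, (N * (∫ x in Ioc ((i:ℝ)/N) ((i:ℝ)/N + 1/N), w x)^2 +
        1/N * ∫ p in Ioc ((i:ℝ)/N) ((i:ℝ)/N + 1/N) ×ˢ Ioc ((i:ℝ)/N) ((i:ℝ)/N + 1/N), gagKer w p) := by
        apply Finset.sum_le_sum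
        intro i _
        have := int_est hw ((i:ℝ)/N) (1/N) (by positivity)
        rwa [show ((1:ℝ)/N)⁻¹ = N by simp] at this
    _ ≤ _ := by
      rw [Finset.sum_add_distrib, ← Finset.mul_sum, ← Finset.mul_sum]
      gcongr

def intFun (hl1 : 0 < lam1) (a h : ℝ) (hh : 0 < h) : StrongDual ℝ HX :=
  LinearMap.mkContinuous
    { toFun := fun g => ∫ x in Ioc a (a+h), rep g x
      map_add' := by
        intro g k
        have i : ∀ g : HX, IntegrableOn (rep g) (Ioc a (a+h)) := fun g =>
          ((rep_mem g).lp.restrict _).integrable (by norm_num)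
        rw [← integral_add (i g) (i k)]
        exact integral_congr_ae (ae_restrict_of_ae (rep_add hl1 g k))
      map_smul' := by
        intro c g
        simp only [RingHom.id_apply, smul_eq_mul]
        rw [← integral_const_mul]
        exact integral_congr_ae (ae_restrict_of_ae (rep_smul hl1 c g)) }
    (√(h / lam1)) (by
      intro g
      simp only [LinearMap.coe_mk, AddHom.coe_mk, norm_eq_abs]
      apply abs_le_of_sq_le_sq _ (by positivity)
      rw [mul_pow, sq_sqrt (by positivity)]
      have h1 := cs_int (rep_mem g).lp a h hh
      have h2 : ∫ x in Ioc a (a+h), (rep g x)^2 ≤ ‖g‖^2 / lam1 := by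
        refine le_trans ?_ (rep_l2 hl1 g)
        rw [← int_full (rep_mem g)]
        exact setIntegral_le_integral (rep_mem g).1.2.1 (Eventually.of_forall fun x => by
          simp only [Pi.zero_apply]; positivity)
      calc _ ≤ _ := h1
        _ ≤ h * (‖g‖^2/lam1) := by gcongr
        _ = _ := by ring)

theorem intFun_apply (hl1 : 0 < lam1) (a h : ℝ) (hh : 0 < h) (g : HX) :
    intFun hl1 a h hh g = ∫ x in Ioc a (a+h), rep g x := rfl

theorem rellich (hl1 : 0 < lam1) (g : ℕ → HX) (R : ℝ) (hR : ∀ n, ‖g n‖ ≤ R)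
    (hweak : ∀ z : HX, Tendsto (fun n => inner ℝ (g n) z) atTop (𝓝 0)) :
    Tendsto (fun n => ∫ x in Ioo (0:ℝ) 1, (rep (g n) x)^2) atTop (𝓝 0) := by
  have := HX_complete hl1
  have hfun : ∀ L : StrongDual ℝ HX, Tendsto (fun n => L (g n)) atTop (𝓝 0) := by
    intro L
    have := hweak ((InnerProductSpace.toDual ℝ HX).symm L)
    refine this.congr fun n => ?_
    rw [real_inner_comm, InnerProductSpace.toDual_symm_apply]
  have hR0 : 0 ≤ R := (norm_nonneg _).trans (hR 0)
  rw [Metric.tendsto_atTop]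
  intro ε hε
  obtain ⟨N, hN⟩ := exists_nat_gt (2 * (R^2 + 1) / ε)
  have hN' : (0:ℝ) < N := lt_trans (by positivity) hN
  have hNn : 0 < N := by exact_mod_cast hN'
  have hlim : Tendsto (fun n => (N:ℝ) * (∑ i ∈ Finset.range N,
      (∫ x in Ioc ((i:ℝ)/N) ((i:ℝ)/N + 1/N), rep (g n) x)^2)) atTop (𝓝 0) := by
    rw [show (0:ℝ) = (N:ℝ) * (∑ i ∈ Finset.range N, (0:ℝ)^2) by simp]
    apply Tendsto.const_mul
    apply tendsto_finsetSum
    intro i _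
    apply Tendsto.pow
    exact hfun (intFun hl1 ((i:ℝ)/N) (1/N) (by positivity))
  have hev := hlim.eventually_lt_const (show (0:ℝ) < ε/2 by positivity)
  obtain ⟨n0, hn0⟩ := eventually_atTop.1 hev
  refine ⟨n0, fun n hn => ?_⟩
  have h0 : 0 ≤ ∫ x in Ioo (0:ℝ) 1, (rep (g n) x)^2 := by positivity
  rw [Real.dist_eq, sub_zero, abs_of_nonneg h0]
  have h1 := rellich_est (rep_mem (g n)) N hNn
  have h2 := hn0 n hn
  rw [← normsq_rep] at h1
  have h3 : 1/N * ‖g n‖^2 ≤ ε / 2 := by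
    rw [div_lt_iff₀ hε] at hN
    have : ‖g n‖^2 ≤ R^2 := by gcongr; exact hR n
    rw [one_div, inv_mul_le_iff₀ hN']
    nlinarith
  linarith

theorem lip_memX {u : ℝ → ℝ} (hu : memX u) {L : ℝ → ℝ} (hL : Measurable L)
    (hL0 : L 0 = 0) (hlip : ∀ a b, |L a - L b| ≤ |a - b|) :
    memX (fun x => L (u x)) ∧ ∀ p, |dq (fun x => L (u x)) p| ≤ |dq u p| := by
  have hd : ∀ p, |dq (fun x => L (u x)) p| ≤ |dq u p| := by
    intro p
    simp only [dq, abs_div]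
    exact div_le_div_of_nonneg_right (hlip _ _) (abs_nonneg _)
  have hm : Measurable (fun x => L (u x)) := hL.comp hu.meas
  refine ⟨?_, hd⟩
  rw [memX_iff]
  refine ⟨hm, ?_, ?_, ?_⟩
  · apply hu.lp.mono hm.aestronglyMeasurable (Eventually.of_forall fun x => ?_)
    have := hlip (u x) 0
    simpa [hL0] using this
  · exact hu.dlp.mono (dq_meas hm).aestronglyMeasurable (Eventually.of_forall hd)
  · filter_upwards [hu.2] with x hx hx2
    rw [hx hx2, hL0]

def trunc (k : ℝ) (t : ℝ) : ℝ := max (-k) (min t k)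

theorem trunc_cont (k : ℝ) : Continuous (trunc k) := by unfold trunc; fun_prop

theorem trunc_zero {k : ℝ} (hk : 0 ≤ k) : trunc k 0 = 0 := by
  unfold trunc; rw [min_eq_left hk, max_eq_right (by linarith)]

theorem trunc_le {k : ℝ} (hk : 0 ≤ k) (t : ℝ) : |trunc k t| ≤ k := by
  unfold trunc
  rw [abs_le]; exact ⟨le_max_left _ _, max_le (by linarith) (min_le_right _ _)⟩

theorem trunc_eq {k t : ℝ} (h : |t| ≤ k) : trunc k t = t := by
  unfold trunc
  rw [abs_le] at h
  rw [min_eq_left h.2, max_eq_right h.1]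

theorem trunc_le_abs {k : ℝ} (hk : 0 ≤ k) (t : ℝ) : |trunc k t| ≤ |t| := by
  rcases le_total |t| k with h | h
  · rw [trunc_eq h]
  · exact (trunc_le hk t).trans h

theorem trunc_mono (k : ℝ) : Monotone (trunc k) := by
  intro a b h; unfold trunc; gcongr

theorem trunc_sub_mono (k : ℝ) : Monotone (fun t => t - trunc k t) := by
  intro a b h
  simp only [trunc]
  rcases max_cases (-k) (min a k) with ⟨h1, h2⟩ | ⟨h1, h2⟩ <;>
  rcases max_cases (-k) (min b k) with ⟨h3, h4⟩ | ⟨h3, h4⟩ <;>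
  rcases min_cases a k with ⟨h5, h6⟩ | ⟨h5, h6⟩ <;>
  rcases min_cases b k with ⟨h7, h8⟩ | ⟨h7, h8⟩ <;> linarith

theorem trunc_lip (k a b : ℝ) : |trunc k a - trunc k b| ≤ |a - b| := by
  rcases le_total a b with h | h
  · have h1 := trunc_mono k h
    have h2 := trunc_sub_mono k h
    simp only at h2
    rw [abs_of_nonpos (by linarith), abs_of_nonpos (by linarith)]; linarith
  · have h1 := trunc_mono k h
    have h2 := trunc_sub_mono k h
    simp only at h2
    rw [abs_of_nonneg (by linarith), abs_of_nonneg (by linarith)]; linarith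

theorem trunc_sub_lip (k a b : ℝ) : |(a - trunc k a) - (b - trunc k b)| ≤ |a - b| := by
  rcases le_total a b with h | h
  · have h1 := trunc_mono k h
    have h2 := trunc_sub_mono k h
    simp only at h2
    rw [abs_of_nonpos (by linarith), abs_of_nonpos (by linarith)]; linarith
  · have h1 := trunc_mono k h
    have h2 := trunc_sub_mono k h
    simp only at h2
    rw [abs_of_nonneg (by linarith), abs_of_nonneg (by linarith)]; linarith

theorem trunc_memX {u : ℝ → ℝ} (hu : memX u) (k : ℕ) : memX (fun x => trunc k (u x)) :=
  (lip_memX hu (trunc_cont k).measurable (trunc_zero (by positivity)) (trunc_lip k)).1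

theorem trunc_tail {u : ℝ → ℝ} (hu : memX u) :
    Tendsto (fun k : ℕ => gagSq (fun x => u x - trunc k (u x))) atTop (𝓝 0) := by
  unfold gagSq
  rw [show (0:ℝ) = ∫ p : ℝ × ℝ, (0:ℝ) by simp]
  apply tendsto_integral_of_dominated_convergence (gagKer u)
  · intro k
    rw [gagKer_eq]
    have : Measurable (fun x => u x - trunc k (u x)) :=
      hu.meas.sub ((trunc_cont k).measurable.comp hu.meas)
    exact ((dq_meas this).pow_const 2).aestronglyMeasurable
  · exact hu.1.2.2
  · intro k
    refine Eventually.of_forall fun p => ?_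
    rw [gagKer_eq, gagKer_eq]
    simp only [norm_eq_abs, abs_pow, sq_abs]
    have := (lip_memX hu (L := fun t => t - trunc k t)
      (measurable_id.sub (trunc_cont k).measurable) (by simp [trunc_zero]) (trunc_sub_lip k)).2 p
    exact sq_le_sq.2 this
  · refine Eventually.of_forall fun p => ?_
    apply tendsto_const_nhds.congr'
    obtain ⟨n, hn⟩ := exists_nat_ge (max |u p.1| |u p.2|)
    filter_upwards [eventually_ge_atTop n] with k hk
    have hk' : (n:ℝ) ≤ k := by exact_mod_cast hk
    simp [gagKer, trunc_eq (((le_max_left _ _).trans hn).trans hk'),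
      trunc_eq (((le_max_right _ _).trans hn).trans hk')]



abbrev mu : Measure ℝ := volume.restrict (Ioo (0:ℝ) 1)

theorem exp_mul_le_add (a b : ℝ) : exp a * exp b ≤ exp (2*a) + exp (2*b) := by
  have h1 : exp (2*a) = exp a ^ 2 := by rw [← exp_nat_mul]; norm_num
  have h2 : exp (2*b) = exp b ^ 2 := by rw [← exp_nat_mul]; norm_num
  rw [h1, h2]
  nlinarith [sq_nonneg (exp a - exp b), sq_nonneg (exp a + exp b), sq_nonneg (exp a), sq_nonneg (exp b)]

theorem exp_meas {u : ℝ → ℝ} (hu : Measurable u) (β : ℝ) : Measurable (fun x => exp (β * (u x)^2)) := by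
  fun_prop

theorem tm_scaled {ω : ℝ} (hTM : TMprop ω) {α : ℝ} (h0 : 0 < α) (h1 : α < 2 * π * ω) :
    ∃ K : ℝ, 0 < K ∧ ∀ u : ℝ → ℝ, memX u → ∀ β R : ℝ, 0 < R → gagSq u ≤ R^2 → β * R^2 ≤ α →
      (∫⁻ x, ENNReal.ofReal (exp (β * (u x) ^ 2)) ∂mu) ≤ ENNReal.ofReal K := by
  obtain ⟨K, hK, h⟩ := hTM α h0 h1
  refine ⟨K, hK, fun u hu β R hR hg hβ => ?_⟩
  have h2 : gagNorm (fun x => R⁻¹ * u x) ≤ 1 := by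
    unfold gagNorm
    rw [gagSq_smul, sqrt_le_one]
    rw [inv_pow, inv_mul_le_iff₀ (by positivity)]; linarith
  refine le_trans (lintegral_mono fun x => ?_) (h _ (memX_smul R⁻¹ hu) h2)
  apply ENNReal.ofReal_le_ofReal
  apply exp_le_exp.2
  calc β * u x ^ 2 = (β * R^2) * (R⁻¹ * u x)^2 := by field_simp
    _ ≤ _ := by gcongr

theorem integrable_of_lint {h : ℝ → ℝ} (hm : Measurable h) (h0 : ∀ x, 0 ≤ h x)
    (hfin : ∫⁻ x, ENNReal.ofReal (h x) ∂mu < ⊤) : Integrable h mu := by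
  refine ⟨hm.aestronglyMeasurable, ?_⟩
  rw [hasFiniteIntegral_iff_ofReal (Eventually.of_forall h0)]
  exact hfin

theorem exp_int {ω : ℝ} (hω : 0 < ω) (hTM : TMprop ω) {u : ℝ → ℝ} (hu : memX u) (β : ℝ) :
    Integrable (fun x => exp (β * (u x)^2)) mu := by
  wlog hβ : 0 < β generalizing β
  · refine (this 1 one_pos).mono' (exp_meas hu.meas β).aestronglyMeasurable (Eventually.of_forall fun x => ?_)
    rw [norm_of_nonneg (exp_pos _).le]
    apply exp_le_exp.2
    nlinarith [sq_nonneg (u x)]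
  have hpi := pi_pos
  obtain ⟨K, hK, hb⟩ := tm_scaled hTM (α := π * ω) (by positivity) (by nlinarith [mul_pos hpi hω])
  set R := √(π * ω / (2 * β)) with hR
  have hR2 : R^2 = π * ω / (2 * β) := sq_sqrt (by positivity)
  have hR0 : 0 < R := sqrt_pos.2 (by positivity)
  obtain ⟨k, hk⟩ := ((trunc_tail hu).eventually_le_const (show (0:ℝ) < R^2 by positivity)).exists
  have h1 := hb _ (memX_sub hu (trunc_memX hu k)) (2 * β) R hR0 hk (by rw [hR2]; field_simp; rfl)
  have hI : Integrable (fun x => exp (2 * β * (u x - trunc k (u x))^2)) mu :=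
    integrable_of_lint (exp_meas (memX_sub hu (trunc_memX hu k)).meas _) (fun x => (exp_pos _).le)
      (h1.trans_lt ENNReal.ofReal_lt_top)
  refine (hI.const_mul (exp (2 * β * k^2))).mono' (exp_meas hu.meas β).aestronglyMeasurable
    (Eventually.of_forall fun x => ?_)
  rw [norm_of_nonneg (exp_pos _).le, ← exp_add]
  apply exp_le_exp.2
  have h2 : trunc k (u x) ^ 2 ≤ (k:ℝ)^2 := sq_le_sq' (abs_le.1 (trunc_le (by positivity) _)).1 (abs_le.1 (trunc_le (by positivity) _)).2
  have h3 : (u x)^2 ≤ 2 * (u x - trunc k (u x))^2 + 2 * k^2 := by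
    nlinarith [sq_nonneg (u x - 2 * trunc k (u x))]
  nlinarith

theorem exp_loc {ω : ℝ} (hω : 0 < ω) (hTM : TMprop ω) (hl1 : 0 < lam1) (g : HX) {β : ℝ} (hβ : 0 < β) :
    ∃ δ > 0, ∃ K : ℝ, 0 < K ∧ ∀ h : HX, ‖h - g‖ ≤ δ →
      ∫⁻ x, ENNReal.ofReal (exp (β * (rep h x)^2)) ∂mu ≤ ENNReal.ofReal K := by
  have hpi := pi_pos
  obtain ⟨K, hK, hb⟩ := tm_scaled hTM (α := π * ω) (by positivity) (by nlinarith [mul_pos hpi hω])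
  set R := √(π * ω / (4 * β)) with hR
  have hR2 : R^2 = π * ω / (4 * β) := sq_sqrt (by positivity)
  have hR0 : 0 < R := sqrt_pos.2 (by positivity)
  have hI := exp_int hω hTM (rep_mem g) (4 * β)
  have hIp : 0 ≤ ∫ x, exp (4 * β * (rep g x)^2) ∂mu := by positivity
  refine ⟨R, hR0, K + ∫ x, exp (4 * β * (rep g x)^2) ∂mu, by positivity, fun h hh => ?_⟩
  have h1 := hb _ (rep_mem (h - g)) (4 * β) R hR0 (by rw [← normsq_rep]; gcongr)
    (by rw [hR2]; field_simp; rfl)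
  rw [ENNReal.ofReal_add hK.le hIp,
    ofReal_integral_eq_lintegral_ofReal hI (Eventually.of_forall fun x => (exp_pos _).le)]
  refine le_trans ?_ (add_le_add_left h1 _)
  rw [← lintegral_add_left (exp_meas (rep_mem (h-g)).meas _).ennreal_ofReal]
  apply lintegral_mono_ae
  filter_upwards [ae_restrict_of_ae (rep_sub hl1 h g)] with x hx
  rw [← ENNReal.ofReal_add (exp_pos _).le (exp_pos _).le]
  apply ENNReal.ofReal_le_ofReal
  have := exp_mul_le_add (2 * β * (rep (h-g) x)^2) (2 * β * (rep g x)^2)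
  rw [← exp_add] at this
  refine le_trans (exp_le_exp.2 ?_) (this.trans (le_of_eq ?_))
  · rw [hx]; nlinarith [sq_nonneg (rep h x - 2 * rep g x)]
  · ring_nf

theorem vitali (h : ℕ → ℝ → ℝ) (h0 : ℝ → ℝ) (W : ℕ → ℝ → ℝ) (K : ℝ) (hK : 0 < K)
    (hi : ∀ n, Integrable (h n) mu) (hi0 : Integrable h0 mu)
    (hae : ∀ᵐ x ∂mu, Tendsto (fun n => h n x) atTop (𝓝 (h0 x)))
    (hW : ∀ n, ∫⁻ x, ENNReal.ofReal (W n x) ∂mu ≤ ENNReal.ofReal K)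
    (hpt : ∀ ε > 0, ∃ C : ℝ, ∀ n x, C ≤ |h n x| → |h n x| ≤ ε * W n x) :
    Tendsto (fun n => ∫ x, h n x ∂mu) atTop (𝓝 (∫ x, h0 x ∂mu)) := by
  apply tendsto_integral_of_L1' h0 hi0.1 (Eventually.of_forall hi)
  apply tendsto_Lp_finite_of_tendsto_ae le_rfl (by simp) (fun n => (hi n).1) (memLp_one_iff_integrable.2 hi0) _ hae
  apply unifIntegrable_of le_rfl (by simp) (fun n => (hi n).1)
  intro ε hε
  obtain ⟨C, hC⟩ := hpt (ε / K) (by positivity)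
  refine ⟨C.toNNReal, fun n => ?_⟩
  rw [eLpNorm_one_eq_lintegral_enorm]
  calc _ ≤ ∫⁻ x, ENNReal.ofReal (ε/K) * ENNReal.ofReal (W n x) ∂mu := by
        apply lintegral_mono
        intro x
        by_cases hy : C.toNNReal ≤ ‖h n x‖₊
        · have hy' : C ≤ |h n x| := by
            have h1 : (C.toNNReal : ℝ) ≤ ‖h n x‖ := by exact_mod_cast hy
            exact (Real.le_coe_toNNReal C).trans h1
          dsimp only
          rw [indicator_of_mem (by exact hy)]
          rw [← ENNReal.ofReal_mul (by positivity), ← ofReal_norm_eq_enorm]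
          exact ENNReal.ofReal_le_ofReal (hC n x hy')
        · dsimp only
          rw [indicator_of_notMem (by exact hy)]
          simp
    _ = ENNReal.ofReal (ε/K) * ∫⁻ x, ENNReal.ofReal (W n x) ∂mu := by
        rw [lintegral_const_mul' _ _ ENNReal.ofReal_ne_top]
    _ ≤ ENNReal.ofReal (ε/K) * ENNReal.ofReal K := by gcongr; exact hW n
    _ = ENNReal.ofReal ε := by
        rw [← ENNReal.ofReal_mul (by positivity)]; congr 1; field_simp

theorem pt_ui {G W : ℝ → ℝ} (hG : Continuous G) {t0 C0 : ℝ} (hC0 : 0 < C0)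
    (hb : ∀ t, t0 ≤ |t| → |G t| * |t| ≤ C0 * W t) :
    ∀ ε > 0, ∃ C : ℝ, 0 < C ∧ ∀ t, C ≤ |G t| → |G t| ≤ ε * W t := by
  intro ε hε
  set L := max t0 (C0/ε)
  obtain ⟨B, hB⟩ := (isCompact_Icc (a := -L) (b := L)).exists_bound_of_continuousOn hG.continuousOn
  refine ⟨max (B + 1) 1, by positivity, fun t ht => ?_⟩
  have htL : L < |t| := by
    by_contra! hcon
    have := hB t (abs_le.1 hcon)
    rw [norm_eq_abs] at this
    have := le_max_left (B+1) 1
    linarith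
  have h1 := hb t ((le_max_left _ _).trans htL.le)
  have h2 : C0 / ε ≤ |t| := (le_max_right _ _).trans htL.le
  have h3 : |G t| * (C0/ε) ≤ C0 * W t := (mul_le_mul_of_nonneg_left h2 (abs_nonneg _)).trans h1
  have : |G t| * (C0/ε) = C0 * (|G t| / ε) := by ring
  rw [this] at h3
  have h4 := le_of_mul_le_mul_left h3 hC0
  rw [div_le_iff₀ hε] at h4
  linarith

theorem ae_subseq (g : ℕ → HX) (w : HX)
    (h : Tendsto (fun n => ∫ x in Ioo (0:ℝ) 1, (rep (g n) x - rep w x)^2) atTop (𝓝 0)) :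
    ∃ ns : ℕ → ℕ, StrictMono ns ∧ ∀ᵐ x ∂mu, Tendsto (fun k => rep (g (ns k)) x) atTop (𝓝 (rep w x)) := by
  apply TendstoInMeasure.exists_seq_tendsto_ae (g := rep w) (f := fun n => rep (g n))
  apply tendstoInMeasure_of_tendsto_eLpNorm (p := 2) (by simp)
    (fun n => (rep_mem (g n)).meas.aestronglyMeasurable) (rep_mem w).meas.aestronglyMeasurable
  have e : ∀ n, eLpNorm (rep (g n) - rep w) 2 mu =
      ENNReal.ofReal (√(∫ x in Ioo (0:ℝ) 1, (rep (g n) x - rep w x)^2)) := by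
    intro n
    have hm : MemLp (rep (g n) - rep w) 2 mu := ((rep_mem (g n)).lp.sub (rep_mem w).lp).restrict _
    rw [hm.eLpNorm_eq_integral_rpow_norm (by simp) (by simp)]
    congr 1
    rw [sqrt_eq_rpow]
    simp
  simp_rw [e]
  have := (ENNReal.continuous_ofReal.comp continuous_sqrt).tendsto 0 |>.comp h
  simpa [Function.comp_def] using this

theorem strong_l2 (hl1 : 0 < lam1) (g : ℕ → HX) (w : HX) (h : Tendsto g atTop (𝓝 w)) :
    Tendsto (fun n => ∫ x in Ioo (0:ℝ) 1, (rep (g n) x - rep w x)^2) atTop (𝓝 0) := by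
  have h1 : Tendsto (fun n => ‖g n - w‖^2 / lam1) atTop (𝓝 0) := by
    have := ((tendsto_iff_norm_sub_tendsto_zero.1 h).pow 2).div_const lam1
    simpa using this
  refine squeeze_zero (fun n => by positivity) (fun n => ?_) h1
  refine le_trans (le_of_eq ?_) (rep_l2 hl1 (g n - w))
  apply integral_congr_ae
  filter_upwards [ae_restrict_of_ae (rep_sub hl1 (g n) w)] with x hx
  rw [hx]

theorem int_GP {ω : ℝ} (hω : 0 < ω) (hTM : TMprop ω) {G P : ℝ → ℝ} (hG : Continuous G) (hP : Continuous P)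
    {C C' β : ℝ} (hGb : ∀ t, |G t| ≤ C * exp (β * t^2)) (hPb : ∀ t, |P t| ≤ C' * exp (β * t^2))
    {u v : ℝ → ℝ} (hu : memX u) (hv : memX v) : Integrable (fun x => G (u x) * P (v x)) mu := by
  have hC : 0 ≤ C := by have := (abs_nonneg _).trans (hGb 0); simpa using this
  have hC' : 0 ≤ C' := by have := (abs_nonneg _).trans (hPb 0); simpa using this
  refine (((exp_int hω hTM hu (2*β)).add (exp_int hω hTM hv (2*β))).const_mul (C * C')).mono'
    ((hG.measurable.comp hu.meas).mul (hP.measurable.comp hv.meas)).aestronglyMeasurable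
    (Eventually.of_forall fun x => ?_)
  rw [norm_mul, norm_eq_abs, norm_eq_abs]
  calc _ ≤ (C * exp (β * (u x)^2)) * (C' * exp (β * (v x)^2)) := by
        gcongr
        · exact hGb _
        · exact hPb _
    _ = C * C' * (exp (β * (u x)^2) * exp (β * (v x)^2)) := by ring
    _ ≤ C * C' * (exp (2 * (β * (u x)^2)) + exp (2 * (β * (v x)^2))) := by
        gcongr; exact exp_mul_le_add _ _
    _ = _ := by simp [mul_assoc]

theorem nl_cont {ω : ℝ} (hω : 0 < ω) (hTM : TMprop ω) (hl1 : 0 < lam1) {G P : ℝ → ℝ}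
    (hG : Continuous G) (hP : Continuous P)
    {C C' β : ℝ} (hβ : 0 < β) (hGb : ∀ t, |G t| ≤ C * exp (β * t^2)) (hPb : ∀ t, |P t| ≤ C' * exp (β * t^2)) :
    Continuous (fun p : HX × HX => ∫ x, G (rep p.1 x) * P (rep p.2 x) ∂mu) := by
  have hC : 0 ≤ C := by have := (abs_nonneg _).trans (hGb 0); simpa using this
  have hC' : 0 ≤ C' := by have := (abs_nonneg _).trans (hPb 0); simpa using this
  rw [continuous_iff_seqContinuous]
  intro q p hq
  have hq1 : Tendsto (fun n => (q n).1) atTop (𝓝 p.1) := (continuous_fst.tendsto p).comp hq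
  have hq2 : Tendsto (fun n => (q n).2) atTop (𝓝 p.2) := (continuous_snd.tendsto p).comp hq
  obtain ⟨δ1, hδ1, K1, hK1, hb1⟩ := exp_loc hω hTM hl1 p.1 (β := 4 * β) (by positivity)
  obtain ⟨δ2, hδ2, K2, hK2, hb2⟩ := exp_loc hω hTM hl1 p.2 (β := 4 * β) (by positivity)
  have ev1 := (tendsto_iff_norm_sub_tendsto_zero.1 hq1).eventually_le_const hδ1
  have ev2 := (tendsto_iff_norm_sub_tendsto_zero.1 hq2).eventually_le_const hδ2
  obtain ⟨N, hN⟩ := eventually_atTop.1 (ev1.and ev2)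
  rw [← tendsto_add_atTop_iff_nat N]
  apply tendsto_of_subseq_tendsto
  intro ns hns
  have hs1 : Tendsto (fun n => (q (ns n + N)).1) atTop (𝓝 p.1) :=
    hq1.comp ((tendsto_add_atTop_nat N).comp hns)
  obtain ⟨ms, hms, hae1⟩ := ae_subseq _ _ (strong_l2 hl1 _ _ hs1)
  have hs2 : Tendsto (fun n => (q (ns (ms n) + N)).2) atTop (𝓝 p.2) :=
    hq2.comp ((tendsto_add_atTop_nat N).comp (hns.comp hms.tendsto_atTop))
  obtain ⟨ls, hls, hae2⟩ := ae_subseq _ _ (strong_l2 hl1 _ _ hs2)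
  refine ⟨fun n => ms (ls n), ?_⟩
  set i : ℕ → ℕ := fun n => ns (ms (ls n)) + N with hidef
  have hiN : ∀ n, N ≤ i n := fun n => Nat.le_add_left _ _
  set A := (C * C')^2 with hA
  refine vitali (fun n x => G (rep (q (i n)).1 x) * P (rep (q (i n)).2 x)) _
    (fun n x => (exp (4 * β * (rep (q (i n)).1 x)^2) + exp (4 * β * (rep (q (i n)).2 x)^2)))
    (K1 + K2) (by positivity) (fun n => int_GP hω hTM hG hP hGb hPb (rep_mem _) (rep_mem _))
    (int_GP hω hTM hG hP hGb hPb (rep_mem _) (rep_mem _)) ?_ ?_ ?_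
  · filter_upwards [hae1, hae2] with x h1 h2
    exact ((hG.tendsto _).comp (h1.comp hls.tendsto_atTop)).mul ((hP.tendsto _).comp h2)
  · intro n
    rw [ENNReal.ofReal_add hK1.le hK2.le]
    simp_rw [ENNReal.ofReal_add (exp_pos _).le (exp_pos _).le]
    rw [lintegral_add_left (exp_meas (rep_mem _).meas _).ennreal_ofReal]
    exact add_le_add (hb1 _ (hN _ (hiN n)).1) (hb2 _ (hN _ (hiN n)).2)
  · intro ε hε
    refine ⟨max ((A+1) / ε) 1, fun n x hx => ?_⟩
    set a := rep (q (i n)).1 x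
    set b := rep (q (i n)).2 x
    have hx1 : (A + 1) / ε ≤ |G a * P b| := (le_max_left _ _).trans hx
    rw [div_le_iff₀ hε] at hx1
    have hx0 : 0 < |G a * P b| := lt_of_lt_of_le (by positivity) hx
    have h1 : |G a * P b| ≤ C * C' * (exp (β * a^2) * exp (β * b^2)) := by
      rw [abs_mul]
      calc _ ≤ (C * exp (β * a^2)) * (C' * exp (β * b^2)) := by
            gcongr
            · exact hGb _
            · exact hPb _
        _ = _ := by ring
    have h2 : |G a * P b|^2 ≤ A * (exp (4 * β * a^2) + exp (4 * β * b^2)) := by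
      calc |G a * P b|^2 ≤ (C * C' * (exp (β * a^2) * exp (β * b^2)))^2 := by gcongr
        _ = A * (exp (2 * (β * a^2)) * exp (2 * (β * b^2))) := by
          rw [mul_pow, ← exp_add, ← exp_nat_mul, ← exp_add]; congr 2; push_cast; ring
        _ ≤ A * (exp (2 * (2 * (β * a^2))) + exp (2 * (2 * (β * b^2)))) := by
          gcongr; exact exp_mul_le_add _ _
        _ = _ := by ring_nf
    have hE : 0 < exp (4 * β * a^2) + exp (4 * β * b^2) := by positivity
    set E := exp (4 * β * a^2) + exp (4 * β * b^2)
    set Y := |G a * P b|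
    -- (A+1) ≤ Y ε, Y² ≤ A E
    have h3 : (A + 1) * Y ≤ (A + 1) * (ε * E) := by
      calc (A+1) * Y ≤ (Y * ε) * Y := by gcongr
        _ = ε * Y^2 := by ring
        _ ≤ ε * (A * E) := by gcongr
        _ ≤ (A + 1) * (ε * E) := by nlinarith [mul_pos hε hE]
    exact le_of_mul_le_mul_left h3 (by positivity)

theorem nl_deriv {ω : ℝ} (hω : 0 < ω) (hTM : TMprop ω) (hl1 : 0 < lam1) {f F : ℝ → ℝ}
    (hf : Continuous f) (hF : ∀ t, HasDerivAt F (f t) t)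
    {C C' β : ℝ} (hβ : 0 < β) (hfb : ∀ t, |f t| ≤ C * exp (β * t^2)) (hFb : ∀ t, |F t| ≤ C' * exp (β * t^2))
    (g v : HX) :
    HasDerivAt (fun s : ℝ => ∫ x, F (rep (g + s • v) x) ∂mu) (∫ x, f (rep g x) * rep v x ∂mu) 0 := by
  have hC : 0 ≤ C := by have := (abs_nonneg _).trans (hfb 0); simpa using this
  have e : (fun s : ℝ => ∫ x, F (rep (g + s • v) x) ∂mu) = fun s => ∫ x, F (rep g x + s * rep v x) ∂mu := by
    funext s
    apply integral_congr_ae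
    filter_upwards [ae_restrict_of_ae (rep_add hl1 g (s • v)), ae_restrict_of_ae (rep_smul hl1 s v)] with x h1 h2
    rw [h1, h2]
  have hFc : Continuous F := continuous_iff_continuousAt.2 fun t => (hF t).continuousAt
  rw [e]
  have hm : ∀ s : ℝ, Measurable (fun x => F (rep g x + s * rep v x)) := fun s =>
    hFc.measurable.comp ((rep_mem g).meas.add ((rep_mem v).meas.const_mul s))
  have key := hasDerivAt_integral_of_dominated_loc_of_deriv_le (μ := mu)
    (F := fun s x => F (rep g x + s * rep v x))
    (F' := fun s x => f (rep g x + s * rep v x) * rep v x) (x₀ := (0:ℝ)) (s := Metric.ball 0 1)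
    (bound := fun x => C * (exp (4 * β * (rep g x)^2) + exp ((4 * β + 2) * (rep v x)^2)))
    (Metric.ball_mem_nhds _ one_pos)
    (Eventually.of_forall fun s => (hm s).aestronglyMeasurable) ?_ ?_ ?_ ?_ ?_
  · have := key.2
    simpa using this
  · simp only [zero_mul, add_zero]
    have := int_GP hω hTM hFc (continuous_const (y := (1:ℝ))) (C' := 1) hFb
      (fun t => by rw [abs_one, one_mul]; exact one_le_exp (by positivity)) (rep_mem g) (rep_mem g)
    simpa using this
  · simp only [zero_mul, add_zero]
    exact ((hf.measurable.comp (rep_mem g).meas).mul (rep_mem v).meas).aestronglyMeasurable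
  · refine Eventually.of_forall fun x s hs => ?_
    set a := rep g x
    set b := rep v x
    have hs1 : |s| < 1 := by simpa using hs
    have hs2 : s^2 ≤ 1 := by rw [← sq_abs]; nlinarith [abs_nonneg s]
    have hb : |b| ≤ exp (b^2) := by
      have := add_one_le_exp (b^2)
      nlinarith [sq_nonneg (|b| - 1), sq_abs b]
    rw [norm_mul, norm_eq_abs, norm_eq_abs]
    calc |f (a + s * b)| * |b| ≤ (C * exp (β * (a + s*b)^2)) * exp (b^2) := by
          gcongr; exact hfb _
      _ ≤ (C * exp (2 * β * a^2 + 2 * β * b^2)) * exp (b^2) := by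
          gcongr
          nlinarith [sq_nonneg (a - s * b), mul_nonneg (sub_nonneg.2 hs2) (sq_nonneg b)]
      _ = C * (exp (2 * β * a^2) * exp ((2 * β + 1) * b^2)) := by
          rw [mul_assoc, ← exp_add, ← exp_add]; congr 2; ring
      _ ≤ C * (exp (2 * (2 * β * a^2)) + exp (2 * ((2 * β + 1) * b^2))) := by
          gcongr; exact exp_mul_le_add _ _
      _ = _ := by ring_nf
  · exact ((exp_int hω hTM (rep_mem g) _).add (exp_int hω hTM (rep_mem v) _)).const_mul C
  · refine Eventually.of_forall fun x s _ => ?_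
    have h1 : HasDerivAt (fun s : ℝ => rep g x + s * rep v x) (rep v x) s := by
      simpa using ((hasDerivAt_id s).mul_const (rep v x)).const_add (rep g x)
    exact (hF _).comp s h1


theorem primF_deriv {f : ℝ → ℝ} (hf : Continuous f) (t : ℝ) : HasDerivAt (primF f) (f t) t := by
  unfold primF
  exact intervalIntegral.integral_hasDerivAt_right (hf.intervalIntegrable _ _)
    hf.stronglyMeasurable.stronglyMeasurableAtFilter hf.continuousAt

theorem primF_zero (f : ℝ → ℝ) : primF f 0 = 0 := by simp [primF]

theorem growth {f : ℝ → ℝ} (hf : Continuous f) {β : ℝ}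
    (h : Tendsto (fun t => |f t| * exp (-β * t ^ 2)) (cocompact ℝ) (𝓝 0)) :
    ∃ C > 0, ∀ t, |f t| ≤ C * exp (β * t^2) := by
  have h1 := h.eventually (gt_mem_nhds (zero_lt_one))
  obtain ⟨S, hS, hSs⟩ := mem_cocompact.1 h1
  have hc : Continuous (fun t => |f t| * exp (-β * t ^ 2)) := by fun_prop
  obtain ⟨B, hB⟩ := hS.exists_bound_of_continuousOn hc.continuousOn
  refine ⟨max B 1, by positivity, fun t => ?_⟩
  have key : |f t| * exp (-β * t ^ 2) ≤ max B 1 := by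
    by_cases ht : t ∈ S
    · exact (le_abs_self _).trans ((hB t ht).trans (le_max_left _ _))
    · exact (le_of_lt (hSs ht)).trans (le_max_right _ _)
  calc |f t| = (|f t| * exp (-β * t ^ 2)) * exp (β * t^2) := by
        rw [mul_assoc, ← exp_add]; simp
    _ ≤ _ := by gcongr

theorem abs_le_exp_sq (t : ℝ) : |t| ≤ exp (t^2) := by
  have := add_one_le_exp (t^2)
  have h2 : |t| ≤ t^2 + 1 := by rw [← sq_abs t]; nlinarith [sq_nonneg (|t| - 1), abs_nonneg t]
  linarith

structure Fc (f : ℝ → ℝ) : Prop where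
  cont : Continuous f
  ar : ∀ t : ℝ, t ≠ 0 → 0 < 2 * primF f t ∧ 2 * primF f t ≤ f t * t

namespace Fc
variable {f : ℝ → ℝ}

theorem F0 (h : Fc f) (t : ℝ) : 0 ≤ primF f t := by
  by_cases ht : t = 0
  · rw [ht, primF_zero]
  · linarith [(h.ar t ht).1]

theorem F1 (h : Fc f) (t : ℝ) : 2 * primF f t ≤ f t * t := by
  by_cases ht : t = 0
  · rw [ht, primF_zero]; simp
  · exact (h.ar t ht).2

theorem ft0 (h : Fc f) (t : ℝ) : 0 ≤ f t * t := by linarith [h.F0 t, h.F1 t]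

theorem ftabs (h : Fc f) (t : ℝ) : |f t| * |t| = f t * t := by
  rw [← abs_mul, abs_of_nonneg (h.ft0 t)]

theorem Fcont (h : Fc f) : Continuous (primF f) :=
  continuous_iff_continuousAt.2 fun t => (primF_deriv h.cont t).continuousAt

theorem growthF (h : Fc f) {β C : ℝ} (hC : 0 < C) (hg : ∀ t, |f t| ≤ C * exp (β * t^2)) (t : ℝ) :
    |primF f t| ≤ C * exp ((β+1) * t^2) := by
  rw [abs_of_nonneg (h.F0 t)]
  have h1 := h.F1 t
  have h2 := h.ftabs t
  have h3 : |f t| * |t| ≤ (C * exp (β * t^2)) * exp (t^2) :=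
    mul_le_mul (hg t) (abs_le_exp_sq t) (abs_nonneg _) (by positivity)
  rw [mul_assoc, ← exp_add] at h3
  rw [show (β+1)*t^2 = β * t^2 + t^2 by ring]
  linarith [h.F0 t]

theorem quot_deriv (h : Fc f) {t : ℝ} (ht : t ≠ 0) :
    HasDerivAt (fun t => primF f t / t^2) (t * (f t * t - 2 * primF f t) / (t^2)^2) t := by
  have := (primF_deriv h.cont t).div (hasDerivAt_pow 2 t) (by positivity)
  refine HasDerivAt.congr_deriv (f := fun t => primF f t / t^2) this ?_
  congr 1
  push_cast; ring

theorem quot_bdd (h : Fc f) : ∃ B, ∀ t, t ≠ 0 → |t| ≤ 1 → primF f t / t^2 ≤ B := by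
  have hm : MonotoneOn (fun t => primF f t / t^2) (Ioi 0) := by
    apply monotoneOn_of_deriv_nonneg (convex_Ioi 0)
    · intro t ht; exact (h.quot_deriv (ne_of_gt ht)).continuousAt.continuousWithinAt
    · rw [interior_Ioi]; intro t ht
      exact (h.quot_deriv (ne_of_gt ht)).differentiableAt.differentiableWithinAt
    · rw [interior_Ioi]; intro t ht
      rw [(h.quot_deriv (ne_of_gt ht)).deriv]
      have : 0 < t := ht
      have := h.F1 t
      apply div_nonneg (mul_nonneg (le_of_lt ht) (by linarith)) (by positivity)
  have ha : AntitoneOn (fun t => primF f t / t^2) (Iio 0) := by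
    apply antitoneOn_of_deriv_nonpos (convex_Iio 0)
    · intro t ht; exact (h.quot_deriv (ne_of_lt ht)).continuousAt.continuousWithinAt
    · rw [interior_Iio]; intro t ht
      exact (h.quot_deriv (ne_of_lt ht)).differentiableAt.differentiableWithinAt
    · rw [interior_Iio]; intro t ht
      rw [(h.quot_deriv (ne_of_lt ht)).deriv]
      have : t < 0 := ht
      have := h.F1 t
      apply div_nonpos_of_nonpos_of_nonneg
        (mul_nonpos_of_nonpos_of_nonneg (le_of_lt ht) (by linarith)) (by positivity)
  refine ⟨max (primF f 1 / 1^2) (primF f (-1) / (-1)^2), fun t ht h1 => ?_⟩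
  rcases lt_or_gt_of_ne ht with h2 | h2
  · exact le_trans (ha (show (-1:ℝ) < 0 by norm_num) h2 (abs_le.1 h1).1) (le_max_right _ _)
  · exact le_trans (hm h2 (show (0:ℝ) < 1 by norm_num) (abs_le.1 h1).2) (le_max_left _ _)

theorem small (h : Fc f)
    (hl : Filter.limsup (fun t => primF f t / t ^ 2) (𝓝[≠] (0 : ℝ)) < lam1 / (4 * π)) :
    0 < lam1 ∧ ∃ m, 0 ≤ m ∧ m < lam1 / (4*π) ∧ ∃ δ > 0, ∀ t, |t| ≤ δ → primF f t ≤ m * t^2 := by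
  obtain ⟨B, hB⟩ := h.quot_bdd
  have hbd : IsBoundedUnder (· ≤ ·) (𝓝[≠] (0 : ℝ)) (fun t => primF f t / t ^ 2) := by
    refine ⟨B, ?_⟩
    rw [eventually_map]
    have h1 : ∀ᶠ t in 𝓝[≠] (0:ℝ), |t| < 1 := by
      apply nhdsWithin_le_nhds
      have : Continuous (fun t : ℝ => |t|) := continuous_abs
      exact this.continuousAt.eventually (gt_mem_nhds (by simp))
    filter_upwards [h1, self_mem_nhdsWithin] with t ht ht0
    exact hB t ht0 ht.le
  have h0 : 0 ≤ Filter.limsup (fun t => primF f t / t ^ 2) (𝓝[≠] (0 : ℝ)) := by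
    apply le_limsup_of_frequently_le _ hbd
    exact Eventually.frequently (Eventually.of_forall fun t => div_nonneg (h.F0 t) (by positivity))
  have hlam : 0 < lam1 / (4*π) := lt_of_le_of_lt h0 hl
  refine ⟨by
    have h4 : 0 < 4 * π := by positivity
    exact (div_pos_iff_of_pos_right h4).1 hlam, ?_⟩
  obtain ⟨m, hm1, hm2⟩ := exists_between hl
  refine ⟨m, h0.trans hm1.le, hm2, ?_⟩
  have := eventually_lt_of_limsup_lt hm1 hbd
  rw [eventually_nhdsWithin_iff, Metric.eventually_nhds_iff] at this
  obtain ⟨δ, hδ, hh⟩ := this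
  refine ⟨δ/2, by positivity, fun t ht => ?_⟩
  by_cases ht0 : t = 0
  · rw [ht0, primF_zero]; simp
  · have := hh (y := t) (by rw [Real.dist_eq, sub_zero]; linarith) ht0
    rw [div_lt_iff₀ (by positivity)] at this
    exact this.le

theorem quad (h : Fc f) {α : ℝ} (hα : 0 < α)
    (hh : Tendsto (fun t => |f t| * exp (-α * t ^ 2)) (cocompact ℝ) atTop) {A : ℝ} (hA : 0 < A) :
    ∃ C, ∀ t, A * t^2 - C ≤ primF f t := by
  have h1 := hh.eventually (eventually_ge_atTop 1)
  rw [← Metric.cobounded_eq_cocompact] at h1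
  obtain ⟨r, hr⟩ := (Metric.hasBasis_cobounded_compl_closedBall (0:ℝ)).eventually_iff.1 h1
  set t1 := max (max (|r|+1) (2*A/α)) 1 with ht1
  have ht1r : r < t1 := by
    have := le_abs_self r
    have : |r| + 1 ≤ t1 := (le_max_left _ _).trans (le_max_left _ _)
    linarith
  have ht1A : 2*A/α ≤ t1 := (le_max_right _ _).trans (le_max_left _ _)
  have ht11 : 1 ≤ t1 := le_max_right _ _
  have hbig : ∀ t, t1 ≤ |t| → 2 * A * |t| ≤ |f t| := by
    intro t ht
    have h2 := hr.2 (show t ∈ (Metric.closedBall (0:ℝ) r)ᶜ by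
      simp only [mem_compl_iff, Metric.mem_closedBall, dist_zero_right, norm_eq_abs, not_le]; linarith)
    have h3 : exp (α * t^2) ≤ |f t| := by
      have : |f t| = (|f t| * exp (-α * t ^ 2)) * exp (α * t^2) := by
        rw [mul_assoc, ← exp_add]; simp
      rw [this]
      exact le_mul_of_one_le_left (exp_pos _).le h2
    have h4 := add_one_le_exp (α * t^2)
    have h5 : 2*A/α ≤ |t| := ht1A.trans ht
    rw [div_le_iff₀ hα] at h5
    have := mul_le_mul_of_nonneg_right h5 (abs_nonneg t)
    have h6 : |t| * α * |t| = α * t^2 := by rw [← sq_abs t]; ring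
    linarith
  have hG : ∀ t, HasDerivAt (fun t => primF f t - A * t^2) (f t - A * (2 * t)) t := by
    intro t
    have := (primF_deriv h.cont t).sub ((hasDerivAt_pow 2 t).const_mul A)
    refine HasDerivAt.congr_deriv (f := fun t => primF f t - A * t^2) this ?_
    push_cast; ring
  have hGc : Continuous (fun t => primF f t - A * t^2) :=
    continuous_iff_continuousAt.2 fun t => (hG t).continuousAt
  obtain ⟨B, hB⟩ := (isCompact_Icc (a := -t1) (b := t1)).exists_bound_of_continuousOn hGc.continuousOn
  have hB' : ∀ t, |t| ≤ t1 → -B ≤ primF f t - A * t^2 := fun t ht => (abs_le.1 (hB t (abs_le.1 ht))).1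
  have hm : MonotoneOn (fun t => primF f t - A * t^2) (Ici t1) := by
    apply monotoneOn_of_deriv_nonneg (convex_Ici t1) hGc.continuousOn
      (fun t _ => (hG t).differentiableAt.differentiableWithinAt)
    rw [interior_Ici]; intro t ht
    have ht : t1 < t := ht
    rw [(hG t).deriv]
    have h2 := hbig t (ht.le.trans (le_abs_self _))
    have h3 := h.ft0 t
    have h4 : 0 < t := by linarith
    have h5 : 0 ≤ f t := nonneg_of_mul_nonneg_left h3 h4
    rw [abs_of_nonneg h5, abs_of_pos h4] at h2
    linarith
  have ha : AntitoneOn (fun t => primF f t - A * t^2) (Iic (-t1)) := by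
    apply antitoneOn_of_deriv_nonpos (convex_Iic (-t1)) hGc.continuousOn
      (fun t _ => (hG t).differentiableAt.differentiableWithinAt)
    rw [interior_Iic]; intro t ht
    have ht : t < -t1 := ht
    rw [(hG t).deriv]
    have h4 : t < 0 := by linarith
    have h2 := hbig t (by rw [abs_of_neg h4]; linarith)
    have h3 := h.ft0 t
    have h5 : f t ≤ 0 := by nlinarith
    rw [abs_of_nonpos h5, abs_of_neg h4] at h2
    linarith
  refine ⟨B, fun t => ?_⟩
  suffices -B ≤ primF f t - A * t^2 by linarith
  have ht0 : 0 < t1 := by linarith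
  rcases le_total |t| t1 with h2 | h2
  · exact hB' t h2
  · rcases le_total 0 t with h3 | h3
    · rw [abs_of_nonneg h3] at h2
      exact (hB' t1 (by rw [abs_of_pos ht0])).trans (hm (mem_Ici.2 le_rfl) h2 h2)
    · rw [abs_of_nonpos h3] at h2
      exact (hB' (-t1) (by rw [abs_neg, abs_of_pos ht0])).trans
        (ha (show t ≤ -t1 by linarith) (mem_Iic.2 le_rfl) (by linarith))

theorem quarter (h : Fc f) {t₀ M : ℝ}
    (hM : ∀ t : ℝ, t₀ ≤ |t| → 0 < primF f t ∧ primF f t ≤ M * |f t|) :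
    ∃ C, 0 ≤ C ∧ ∀ t, primF f t ≤ f t * t / 4 + C := by
  set L := max t₀ (4 * M)
  obtain ⟨B, hB⟩ := (isCompact_Icc (a := -L) (b := L)).exists_bound_of_continuousOn h.Fcont.continuousOn
  refine ⟨max B 0, le_max_right _ _, fun t => ?_⟩
  have h0 := h.ft0 t
  rcases le_total |t| L with h2 | h2
  · have := (le_abs_self _).trans (hB t (abs_le.1 h2))
    have := le_max_left B 0
    linarith
  · have h3 := (hM t ((le_max_left _ _).trans h2)).2
    have h4 : 4 * M ≤ |t| := (le_max_right _ _).trans h2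
    rw [← h.ftabs]
    have := mul_le_mul_of_nonneg_right h4 (abs_nonneg (f t))
    have := le_max_right B 0
    linarith

end Fc


structure Ctx (ω : ℝ) (f : ℝ → ℝ) (C β : ℝ) : Prop where
  hω : 0 < ω
  hTM : TMprop ω
  hl1 : 0 < lam1
  fc : Fc f
  hC : 0 < C
  hβ : 0 < β
  gf : ∀ t, |f t| ≤ C * exp (β * t^2)
  gF : ∀ t, |primF f t| ≤ C * exp (β * t^2)
  gid : ∀ t : ℝ, |t| ≤ 1 * exp (β * t^2)

def Phi (f : ℝ → ℝ) (g : HX) : ℝ := ‖g‖^2 / (4*π) - ∫ x, primF f (rep g x) ∂mu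
def DPhi (f : ℝ → ℝ) (g v : HX) : ℝ := inner ℝ g v / (2*π) - ∫ x, f (rep g x) * rep v x ∂mu

theorem one_le_g {β : ℝ} (hβ : 0 < β) (t : ℝ) : |(1:ℝ)| ≤ 1 * exp (β * t^2) := by
  rw [abs_one, one_mul]; exact one_le_exp (by positivity)

theorem hx_inner_smul (u v : HX) (c : ℝ) : inner ℝ u (c • v) = c * inner ℝ u v :=
  real_inner_smul_right u v c

namespace Ctx
variable {ω : ℝ} {f : ℝ → ℝ} {C β : ℝ}

theorem intF (h : Ctx ω f C β) {u : ℝ → ℝ} (hu : memX u) : Integrable (fun x => primF f (u x)) mu := by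
  have := int_GP h.hω h.hTM h.fc.Fcont (continuous_const (y := (1:ℝ))) h.gF (one_le_g h.hβ) hu hu
  simpa using this

theorem intfv (h : Ctx ω f C β) {u v : ℝ → ℝ} (hu : memX u) (hv : memX v) :
    Integrable (fun x => f (u x) * v x) mu :=
  int_GP h.hω h.hTM h.fc.cont continuous_id h.gf h.gid hu hv

theorem Phi_cont (h : Ctx ω f C β) : Continuous (Phi f) := by
  have h1 := nl_cont h.hω h.hTM h.hl1 h.fc.Fcont (continuous_const (y := (1:ℝ))) h.hβ h.gF (one_le_g h.hβ)
  have h2 := h1.comp (continuous_id.prodMk continuous_id)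
  unfold Phi
  simp only [Function.comp_def, mul_one, id] at h2
  exact (by fun_prop : Continuous fun g : HX => ‖g‖^2/(4*π)).sub h2

theorem D_cont (h : Ctx ω f C β) : Continuous (fun p : HX × HX => DPhi f p.1 p.2) := by
  have h1 := nl_cont h.hω h.hTM h.hl1 h.fc.cont continuous_id h.hβ h.gf h.gid
  unfold DPhi
  exact ((continuous_fst.inner continuous_snd).div_const _).sub h1

theorem D_add (h : Ctx ω f C β) (u v w : HX) : DPhi f u (v+w) = DPhi f u v + DPhi f u w := by
  unfold DPhi
  have : ∫ x, f (rep u x) * rep (v+w) x ∂mu = ∫ x, f (rep u x) * rep v x ∂mu + ∫ x, f (rep u x) * rep w x ∂mu := by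
    rw [← integral_add (h.intfv (rep_mem u) (rep_mem v)) (h.intfv (rep_mem u) (rep_mem w))]
    apply integral_congr_ae
    filter_upwards [ae_restrict_of_ae (rep_add h.hl1 v w)] with x hx
    rw [hx]; ring
  rw [this, inner_add_right]; ring

theorem D_smul (h : Ctx ω f C β) (u : HX) (c : ℝ) (v : HX) : DPhi f u (c•v) = c * DPhi f u v := by
  unfold DPhi
  have : ∫ x, f (rep u x) * rep (c•v) x ∂mu = c * ∫ x, f (rep u x) * rep v x ∂mu := by
    rw [← integral_const_mul]
    apply integral_congr_ae
    filter_upwards [ae_restrict_of_ae (rep_smul h.hl1 c v)] with x hx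
    rw [hx]; ring
  rw [this, hx_inner_smul]; ring

theorem D_der (h : Ctx ω f C β) (u v : HX) : HasDerivAt (fun s : ℝ => Phi f (u + s•v)) (DPhi f u v) 0 := by
  have h1 := nl_deriv h.hω h.hTM h.hl1 h.fc.cont (primF_deriv h.fc.cont) h.hβ h.gf h.gF u v
  have h2 : HasDerivAt (fun s : ℝ => ‖u + s•v‖^2 / (4*π)) (inner ℝ u v / (2*π)) 0 := by
    have e : (fun s : ℝ => ‖u + s•v‖^2 / (4*π)) = fun s => (‖u‖^2 + s * (2 * inner ℝ u v) + s^2 * ‖v‖^2) / (4*π) := by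
      funext s
      rw [norm_add_sq_real, hx_inner_smul, norm_smul, mul_pow, norm_eq_abs, sq_abs]; ring
    rw [e]
    have h3 := ((((hasDerivAt_id (0:ℝ)).mul_const (2 * inner ℝ u v)).const_add (‖u‖^2)).add
      ((hasDerivAt_pow 2 (0:ℝ)).mul_const (‖v‖^2))).div_const (4*π)
    refine HasDerivAt.congr_deriv
      (f := fun s : ℝ => (‖u‖^2 + s * (2 * inner ℝ u v) + s^2 * ‖v‖^2) / (4*π)) h3 ?_
    field_simp; norm_num; ring
  exact h2.sub h1

theorem int_exp_le (h : Ctx ω f C β) {u : ℝ → ℝ} (hu : memX u) {b K : ℝ} (hK : 0 < K)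
    (hb : (∫⁻ x, ENNReal.ofReal (exp (b * (u x) ^ 2)) ∂mu) ≤ ENNReal.ofReal K) :
    ∫ x, exp (b * (u x)^2) ∂mu ≤ K := by
  rw [← ofReal_integral_eq_lintegral_ofReal (exp_int h.hω h.hTM hu b)
    (Eventually.of_forall fun x => (exp_pos _).le)] at hb
  exact (ENNReal.ofReal_le_ofReal_iff hK.le).1 hb

theorem sq_int {u : ℝ → ℝ} (hu : memX u) : Integrable (fun x => (u x)^2) mu :=
  hu.1.2.1.integrableOn

theorem geom (h : Ctx ω f C β)
    {m : ℝ} (hm0 : 0 ≤ m) (hm : m < lam1 / (4*π)) {δ : ℝ} (hδ : 0 < δ) (hδ2 : ∀ t, |t| ≤ δ → primF f t ≤ m * t^2) :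
    ∃ ρ > 0, ∃ a > 0, ∀ g : HX, ‖g‖ = ρ → a ≤ Phi f g := by
  have hω := h.hω
  have hC := h.hC
  have hβ := h.hβ
  have hl1 := h.hl1
  have hpi := pi_pos
  set κ := π * ω / 2 with hκ
  have hκ0 : 0 < κ := by positivity
  obtain ⟨K, hK, hKb⟩ := tm_scaled h.hTM (α := π * ω) (by positivity) (by nlinarith [mul_pos hpi hω])
  set K1 := 1 + 2 / κ^2 with hK1
  have hs3 : ∀ s : ℝ, |s|^3 ≤ K1 * exp (κ * s^2) := by
    intro s
    have h1 := quadratic_le_exp_of_nonneg (show 0 ≤ κ * s^2 by positivity)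
    have h2 : |s|^3 ≤ 1 + s^4 := by
      have : s^4 = |s|^4 := by rw [← abs_pow, abs_of_nonneg (by positivity)]
      rw [this]
      have := abs_nonneg s
      rcases le_total |s| 1 with h3 | h3
      · have := pow_le_one₀ this h3 (n := 3)
        have := pow_nonneg (abs_nonneg s) 4
        linarith
      · have := pow_le_pow_right₀ h3 (show 3 ≤ 4 by norm_num)
        linarith
    have h3 : 1 ≤ exp (κ * s^2) := one_le_exp (by positivity)
    have h4 : s^4 ≤ 2/κ^2 * exp (κ * s^2) := by
      rw [div_mul_eq_mul_div, le_div_iff₀ (by positivity)]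
      nlinarith [show 0 ≤ κ * s^2 by positivity]
    rw [hK1]; linarith
  have hK10 : 0 < K1 := by positivity
  set C1 := C / δ^3 with hC1
  have hC10 : 0 < C1 := by positivity
  have hF : ∀ t, primF f t ≤ m * t^2 + C1 * (|t|^3 * exp (β * t^2)) := by
    intro t
    rcases le_total |t| δ with h1 | h1
    · have := hδ2 t h1
      have : 0 ≤ C1 * (|t|^3 * exp (β * t^2)) := by positivity
      linarith
    · have h2 := (le_abs_self _).trans (h.gF t)
      have h3 : 1 ≤ |t|^3 / δ^3 := by
        rw [one_le_div (by positivity)]; gcongr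
      have h4 : C * exp (β * t^2) ≤ (|t|^3 / δ^3) * (C * exp (β * t^2)) :=
        le_mul_of_one_le_left (by positivity) h3
      have h5 : (|t|^3 / δ^3) * (C * exp (β * t^2)) = C1 * (|t|^3 * exp (β * t^2)) := by rw [hC1]; ring
      have : 0 ≤ m * t^2 := by positivity
      linarith
  set c0 := 1/(4*π) - m/lam1 with hc0
  have hc00 : 0 < c0 := by
    rw [hc0, sub_pos, div_lt_div_iff₀ hl1 (by positivity)]
    rw [lt_div_iff₀ (by positivity)] at hm
    linarith
  set C2 := C1 * K1 * K with hC2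
  have hC20 : 0 < C2 := by positivity
  set r := min (min 1 (κ/β)) (c0 / (2*C2)) with hr
  have hr0 : 0 < r := by positivity
  have hr1 : r ≤ 1 := (min_le_left _ _).trans (min_le_left _ _)
  have hr2 : r ≤ κ/β := (min_le_left _ _).trans (min_le_right _ _)
  have hr3 : r ≤ c0 / (2*C2) := min_le_right _ _
  have hr4 : β * r^2 ≤ κ := by
    have : r^2 ≤ κ/β := by nlinarith
    rw [le_div_iff₀ hβ] at this; linarith
  refine ⟨r, hr0, r^2 * (c0/2), by positivity, fun g hg => ?_⟩
  have hm1 := rep_mem g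
  have hexp := h.int_exp_le hm1 hK (hKb (rep g) hm1 (π*ω/r^2) r hr0
    (by rw [← normsq_rep, hg]) (by rw [div_mul_cancel₀ _ (by positivity)]))
  have hpt : ∀ t, primF f t ≤ m * t^2 + C1 * K1 * r^3 * exp (π*ω/r^2 * t^2) := by
    intro t
    refine (hF t).trans ?_
    have h1 := hs3 (t / r)
    have h2 : exp (β * t^2) ≤ exp (κ * (t/r)^2) := by
      apply exp_le_exp.2
      rw [div_pow, mul_div_assoc', le_div_iff₀ (by positivity)]
      nlinarith [sq_nonneg t]
    have h3 := mul_le_mul h1 h2 (exp_pos _).le (by positivity)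
    rw [mul_assoc K1, ← exp_add, abs_div, abs_of_pos hr0, div_pow] at h3
    have h4 : κ * (t/r)^2 + κ * (t/r)^2 = π*ω/r^2*t^2 := by rw [hκ]; ring
    rw [h4] at h3
    have h5 : |t|^3 * exp (β * t^2) = r^3 * (|t|^3/r^3 * exp (β * t^2)) := by field_simp
    rw [h5]
    have := mul_le_mul_of_nonneg_left h3 (show 0 ≤ C1 * r^3 by positivity)
    linarith
  have hint : ∫ x, primF f (rep g x) ∂mu ≤ m * ∫ x, (rep g x)^2 ∂mu + C1 * K1 * r^3 * ∫ x, exp (π*ω/r^2 * (rep g x)^2) ∂mu := by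
    rw [← integral_const_mul, ← integral_const_mul, ← integral_add ((sq_int hm1).const_mul _)
      ((exp_int hω h.hTM hm1 _).const_mul _)]
    apply integral_mono (h.intF hm1) (((sq_int hm1).const_mul _).add
      ((exp_int hω h.hTM hm1 _).const_mul _))
    intro x; exact hpt _
  have hl2 := rep_l2 hl1 g
  rw [hg] at hl2
  have e1 : m * ∫ x, (rep g x)^2 ∂mu ≤ m * (r^2/lam1) := mul_le_mul_of_nonneg_left hl2 hm0
  have e2 : C1 * K1 * r^3 * ∫ x, exp (π*ω/r^2 * (rep g x)^2) ∂mu ≤ C1 * K1 * r^3 * K :=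
    mul_le_mul_of_nonneg_left hexp (by positivity)
  have e3 : C2 * r ≤ c0/2 := by
    rw [le_div_iff₀ (by positivity)] at hr3; linarith
  have e4 : r^2 * (C2 * r) ≤ r^2 * (c0/2) := mul_le_mul_of_nonneg_left e3 (by positivity)
  have e5 : r^2/(4*π) - m * (r^2/lam1) = r^2 * c0 := by rw [hc0]; ring
  have e6 : C1 * K1 * r^3 * K = r^2 * (C2 * r) := by rw [hC2]; ring
  unfold Phi
  rw [hg]; linarith

theorem Phi_zero (h : Ctx ω f C β) : Phi f 0 = 0 := by
  unfold Phi
  have : ∫ x, primF f (rep 0 x) ∂mu = 0 := by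
    rw [← integral_zero ℝ ℝ (μ := mu)]
    apply integral_congr_ae
    filter_upwards [ae_restrict_of_ae (rep_zero h.hl1)] with x hx
    rw [hx]; simp [primF_zero]
  rw [this]; simp

theorem l2pos (h : Ctx ω f C β) (g : HX) (hg : g ≠ 0) : 0 < ∫ x, (rep g x)^2 ∂mu := by
  refine lt_of_le_of_ne (integral_nonneg fun x => sq_nonneg _) fun h0 => hg ?_
  have h1 := (integral_eq_zero_iff_of_nonneg (fun x => sq_nonneg _) (sq_int (rep_mem g))).1 h0.symm
  have h2 := (ae_restrict_iff' measurableSet_Ioo).1 h1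
  have h3 : rep g =ᵐ[volume] (fun _ => 0) := by
    filter_upwards [h2, (rep_mem g).2] with x hx hx2
    by_cases hx3 : x ∈ Ioo (0:ℝ) 1
    · have := hx hx3
      simpa using this
    · exact hx2 hx3
  have h4 : dq (rep g) =ᵐ[volume] dq (fun _ => 0) := dq_ae_congr h3
  have h5 : gagSq (rep g) = 0 := by
    unfold gagSq
    rw [← integral_zero (ℝ × ℝ) ℝ (μ := volume)]
    apply integral_congr_ae
    filter_upwards [h4] with p hp
    rw [gagKer_eq]; dsimp only; rw [hp]; simp [dq]
  rw [← normsq_rep] at h5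
  exact norm_eq_zero.1 (by simpa using h5)

theorem endpt (h : Ctx ω f C β) {α : ℝ} (hα : 0 < α)
    (hh : Tendsto (fun t => |f t| * exp (-α * t ^ 2)) (cocompact ℝ) atTop) (g : HX) (hg : ‖g‖ = 1) (ρ : ℝ) (hρ : 0 < ρ) :
    ∃ T, ρ < T ∧ Phi f (T • g) < 0 := by
  have hI := h.l2pos g (by rintro rfl; simp at hg)
  set I := ∫ x, (rep g x)^2 ∂mu with hIdef
  obtain ⟨c, hc⟩ := h.fc.quad hα hh (A := 1/I) (by positivity)
  set T := ρ + 1 + 2 * |c| with hT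
  have hc0 := abs_nonneg c
  have hT1 : 1 ≤ T := by linarith
  refine ⟨T, by linarith, ?_⟩
  have h1 : T^2 - c ≤ ∫ x, primF f (rep (T•g) x) ∂mu := by
    have e : ∫ x, (1/I * (T^2 * (rep g x)^2) - c) ∂mu = T^2 - c := by
      rw [integral_sub (((sq_int (rep_mem g)).const_mul _).const_mul _) (integrable_const _),
        integral_const_mul, integral_const_mul, ← hIdef]
      simp
      field_simp
    rw [← e]
    apply integral_mono_ae ((((sq_int (rep_mem g)).const_mul _).const_mul _).sub (integrable_const _))
      (h.intF (rep_mem _))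
    filter_upwards [ae_restrict_of_ae (rep_smul h.hl1 T g)] with x hx
    have := hc (rep (T•g) x)
    rw [hx, mul_pow] at this
    rw [hx]; exact this
  unfold Phi
  rw [norm_smul, hg, mul_one, norm_eq_abs, sq_abs]
  have h2 : T^2/(4*π) ≤ T^2/2 := by
    gcongr; linarith [pi_gt_three]
  have : T ≤ T^2 := by nlinarith
  have := le_abs_self c
  linarith

theorem ps_seq (h : Ctx ω f C β)
    {m : ℝ} (hm0 : 0 ≤ m) (hm : m < lam1 / (4*π)) {δ : ℝ} (hδ : 0 < δ) (hδ2 : ∀ t, |t| ≤ δ → primF f t ≤ m * t^2)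
    {α : ℝ} (hα : 0 < α)
    (hh : Tendsto (fun t => |f t| * exp (-α * t ^ 2)) (cocompact ℝ) atTop)
    {ψ : ℝ → ℝ} (hψ : memX ψ) (hψ1 : gagNorm ψ = 1) {b : ℝ}
    (hb : ∀ t : ℝ, 0 < t → t ^ 2 / (4 * π) - (∫ x in Ioo (0 : ℝ) 1, primF f (t * ψ x)) ≤ b) :
    ∃ a > 0, ∃ u : ℕ → HX, (∀ n, a ≤ Phi f (u n)) ∧ (∀ n, Phi f (u n) ≤ max b 0) ∧
      ∀ n v, |DPhi f (u n) v| ≤ (1 / ((n:ℝ)+1)) * ‖v‖ := by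
  obtain ⟨ρ, hρ, a, ha, hsph⟩ := h.geom hm0 hm hδ hδ2
  set e := toHX ψ hψ with he
  have hen : ‖e‖ = 1 := by rw [← hψ1]; exact (gagSq_congr_of e (toHX_spec ψ hψ)).symm
  obtain ⟨T, hT, hTneg⟩ := h.endpt hα hh e hen ρ hρ
  have hT0 : 0 < T := hρ.trans hT
  have := HX_complete h.hl1
  have hray : ∀ s ∈ Icc (0:ℝ) 1, Phi f (s • (T • e)) ≤ max b 0 := by
    intro s hs
    rw [smul_smul]
    rcases eq_or_lt_of_le hs.1 with h0 | h0
    · rw [← h0]; simp [h.Phi_zero]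
    · refine le_trans ?_ (le_max_left _ _)
      have h1 : 0 < s * T := mul_pos h0 hT0
      refine le_trans (le_of_eq ?_) (hb _ h1)
      unfold Phi
      rw [norm_smul, hen, mul_one, norm_eq_abs, sq_abs]
      congr 1
      apply integral_congr_ae
      filter_upwards [ae_restrict_of_ae (rep_smul h.hl1 (s*T) e), ae_restrict_of_ae (rep_toHX h.hl1 ψ hψ)] with x hx hx2
      rw [hx, hx2]
  have key : ∀ n : ℕ, ∃ u : HX, a/2 ≤ Phi f u ∧ Phi f u ≤ max b 0 ∧ ∀ v, |DPhi f u v| ≤ (1 / ((n:ℝ)+1)) * ‖v‖ := by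
    intro n
    obtain ⟨u, h1, h2, h3⟩ := mountain_pass_aux (Phi f) (DPhi f) h.Phi_cont h.D_cont h.D_add h.D_smul h.D_der (T • e) ρ a (max b 0)
      hρ (by rw [norm_smul, hen, mul_one, norm_eq_abs, abs_of_pos hT0]; exact hT)
      (by rw [h.Phi_zero]; exact ha) (hTneg.trans ha) hsph hray (min (a/2) (1/((n:ℝ)+1)/2)) (by positivity)
    refine ⟨u, ?_, h2, fun v => (h3 v).trans ?_⟩
    · have := min_le_left (a/2) (1/((n:ℝ)+1)/2); linarith
    · have := min_le_right (a/2) (1/((n:ℝ)+1)/2)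
      gcongr; linarith
  choose u h1 h2 h3 using key
  exact ⟨a/2, by positivity, u, h1, h2, h3⟩

end Ctx


namespace Ctx
variable {ω : ℝ} {f : ℝ → ℝ} {C β : ℝ}

theorem intff (h : Ctx ω f C β) (u : HX) : Integrable (fun x => f (rep u x) * rep u x) mu :=
  h.intfv (rep_mem u) (rep_mem u)

theorem ps_bdd (h : Ctx ω f C β) {t₀ M : ℝ}
    (hM : ∀ t : ℝ, t₀ ≤ |t| → 0 < primF f t ∧ primF f t ≤ M * |f t|) (c : ℝ) (hc : 0 ≤ c) :
    ∃ R > 0, ∃ K > 0, ∀ u : HX, Phi f u ≤ c → (∀ v, |DPhi f u v| ≤ ‖v‖) →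
      ‖u‖ ≤ R ∧ ∫ x, f (rep u x) * rep u x ∂mu ≤ K := by
  obtain ⟨Cq, hCq, hq⟩ := h.fc.quarter hM
  have hpi := pi_gt_three
  set A := 4 * c + 4 * Cq with hA
  have hA0 : 0 ≤ A := by positivity
  set R := 2 * π * (A+1) + 1 with hR
  have hR0 : 0 < R := by positivity
  refine ⟨R, hR0, R^2 + R, by positivity, fun u h1 h2 => ?_⟩
  have h3 := h2 u
  have h4 : ∫ x, primF f (rep u x) ∂mu ≤ (∫ x, f (rep u x) * rep u x ∂mu) / 4 + Cq := by
    have e : ∫ x, (f (rep u x) * rep u x / 4 + Cq) ∂mu = (∫ x, f (rep u x) * rep u x ∂mu) / 4 + Cq := by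
      rw [integral_add ((h.intff u).div_const _) (integrable_const _), integral_div]
      simp
    rw [← e]
    exact integral_mono (h.intF (rep_mem u)) (((h.intff u).div_const _).add (integrable_const _))
      (fun x => hq _)
  unfold Phi at h1
  unfold DPhi at h3
  rw [real_inner_self_eq_norm_sq] at h3
  set I := ∫ x, f (rep u x) * rep u x ∂mu
  set J := ∫ x, primF f (rep u x) ∂mu
  set X := ‖u‖
  have hX : 0 ≤ X := norm_nonneg _
  have h5 := abs_le.1 h3
  have e1 : X^2/(4*π) = X^2/(2*π)/2 := by field_simp; norm_num
  rw [e1] at h1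
  have h6 : X^2/(2*π) ≤ A + X := by rw [hA]; linarith [h5.1, h5.2]
  have h7 : X^2 ≤ 2 * π * (A + X) := by
    rw [div_le_iff₀ (by positivity)] at h6; linarith
  have h8 : X ≤ R := by
    by_contra! hcon
    have h9 : 1 ≤ X := by
      have : 0 ≤ 2 * π * (A+1) := by positivity
      linarith
    have : X^2 ≤ 2 * π * (A+1) * X := by
      have : A + X ≤ (A+1) * X := by nlinarith
      nlinarith
    nlinarith
  refine ⟨h8, ?_⟩
  have h9 : X^2/(2*π) ≤ X^2 := div_le_self (by positivity) (by linarith)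
  have : X^2 ≤ R^2 := by gcongr
  linarith [h5.1]

theorem extract (h : Ctx ω f C β) (u : ℕ → HX) (R : ℝ) (hR : ∀ n, ‖u n‖ ≤ R) :
    ∃ w : HX, ∃ g : ℕ → ℕ, StrictMono g ∧
      (∀ z : HX, Tendsto (fun k => inner ℝ (u (g k)) z) atTop (𝓝 (inner ℝ w z))) ∧
      ∀ᵐ x ∂mu, Tendsto (fun k => rep (u (g k)) x) atTop (𝓝 (rep w x)) := by
  have := HX_complete h.hl1
  obtain ⟨w, g, hg, hw⟩ := weak_seq_aux u R hR
  have h1 := rellich h.hl1 (fun k => u (g k) - w) (R + ‖w‖)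
    (fun n => (norm_sub_le _ _).trans (by gcongr; exact hR _))
    (fun z => by
      have := (hw z).sub_const (inner ℝ w z)
      simp only [sub_self] at this
      simpa only [inner_sub_left] using this)
  have h2 : Tendsto (fun n => ∫ x in Ioo (0:ℝ) 1, (rep (u (g n)) x - rep w x)^2) atTop (𝓝 0) := by
    refine h1.congr fun n => ?_
    apply integral_congr_ae
    filter_upwards [ae_restrict_of_ae (rep_sub h.hl1 (u (g n)) w)] with x hx
    rw [hx]
  obtain ⟨ns, hns, hae⟩ := ae_subseq (fun k => u (g k)) w h2
  exact ⟨w, g ∘ ns, hg.comp hns, fun z => (hw z).comp hns.tendsto_atTop, hae⟩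

theorem hW_of (h : Ctx ω f C β) {u : HX} {K : ℝ} (hK : ∫ x, f (rep u x) * rep u x ∂mu ≤ K) :
    ∫⁻ x, ENNReal.ofReal (f (rep u x) * rep u x) ∂mu ≤ ENNReal.ofReal K := by
  rw [← ofReal_integral_eq_lintegral_ofReal (h.intff u) (Eventually.of_forall fun x => h.fc.ft0 _)]
  exact ENNReal.ofReal_le_ofReal hK

theorem limF (h : Ctx ω f C β) {t₀ M : ℝ} (hM0 : 0 < M)
    (hM : ∀ t : ℝ, t₀ ≤ |t| → 0 < primF f t ∧ primF f t ≤ M * |f t|) (u : ℕ → HX) (w : HX)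
    (hae : ∀ᵐ x ∂mu, Tendsto (fun k => rep (u k) x) atTop (𝓝 (rep w x)))
    {K : ℝ} (hK0 : 0 < K) (hK : ∀ n, ∫ x, f (rep (u n) x) * rep (u n) x ∂mu ≤ K) :
    Tendsto (fun n => ∫ x, primF f (rep (u n) x) ∂mu) atTop (𝓝 (∫ x, primF f (rep w x) ∂mu)) := by
  apply vitali (fun n x => primF f (rep (u n) x)) (fun x => primF f (rep w x))
    (fun n x => f (rep (u n) x) * rep (u n) x) K hK0 (fun n => h.intF (rep_mem _)) (h.intF (rep_mem _))
  · filter_upwards [hae] with x hx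
    exact (h.fc.Fcont.tendsto _).comp hx
  · exact fun n => h.hW_of (hK n)
  · intro ε hε
    obtain ⟨c, _, hc⟩ := pt_ui (G := primF f) (W := fun t => f t * t) h.fc.Fcont (t0 := t₀) hM0
      (fun t ht => by
        rw [abs_of_nonneg (h.fc.F0 t), ← h.fc.ftabs, ← mul_assoc]
        exact mul_le_mul_of_nonneg_right (hM t ht).2 (abs_nonneg _)) ε hε
    exact ⟨c, fun n x => hc _⟩

theorem limfv (h : Ctx ω f C β) (u : ℕ → HX) (w : HX)
    (hae : ∀ᵐ x ∂mu, Tendsto (fun k => rep (u k) x) atTop (𝓝 (rep w x)))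
    {K : ℝ} (hK0 : 0 < K) (hK : ∀ n, ∫ x, f (rep (u n) x) * rep (u n) x ∂mu ≤ K)
    {v : ℝ → ℝ} (hv : memX v) {k : ℝ} (hk : 0 < k) (hvk : ∀ x, |v x| ≤ k) :
    Tendsto (fun n => ∫ x, f (rep (u n) x) * v x ∂mu) atTop (𝓝 (∫ x, f (rep w x) * v x ∂mu)) := by
  apply vitali (fun n x => f (rep (u n) x) * v x) (fun x => f (rep w x) * v x)
    (fun n x => f (rep (u n) x) * rep (u n) x) K hK0 (fun n => h.intfv (rep_mem _) hv) (h.intfv (rep_mem _) hv)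
  · filter_upwards [hae] with x hx
    exact ((h.fc.cont.tendsto _).comp hx).mul_const _
  · exact fun n => h.hW_of (hK n)
  · intro ε hε
    obtain ⟨c, _, hc⟩ := pt_ui (G := f) (W := fun t => f t * t) h.fc.cont (t0 := 0) (C0 := 1) one_pos
      (fun t ht => by rw [h.fc.ftabs, one_mul]) (ε/k) (by positivity)
    refine ⟨c * k, fun n x hx => ?_⟩
    rw [abs_mul] at hx ⊢
    have h1 : |f (rep (u n) x)| * |v x| ≤ |f (rep (u n) x)| * k :=
      mul_le_mul_of_nonneg_left (hvk x) (abs_nonneg _)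
    have h2 := hc (rep (u n) x) (le_of_mul_le_mul_right (hx.trans h1) hk)
    refine h1.trans ((mul_le_mul_of_nonneg_right h2 hk.le).trans (le_of_eq ?_))
    field_simp

theorem trunc_lim (z : HX) :
    Tendsto (fun k : ℕ => toHX _ (trunc_memX (rep_mem z) k)) atTop (𝓝 z) := by
  rw [tendsto_iff_norm_sub_tendsto_zero]
  have h1 := (trunc_tail (rep_mem z)).sqrt
  rw [Real.sqrt_zero] at h1
  refine h1.congr fun k => ?_
  rw [norm_sub_rev]
  generalize hy : toHX _ (trunc_memX (rep_mem z) k) = y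
  have hs : (y : L2) =ᵐ[volume] dq (fun x => trunc k (rep z x)) := by
    rw [← hy]; exact toHX_spec _ _
  have hd : ((z - y : HX) : L2) =ᵐ[volume] dq (fun x => rep z x - trunc k (rep z x)) := by
    rw [dq_sub]
    exact (Lp.coeFn_sub (z : L2) (y : L2)).trans ((rep_spec z).sub hs)
  exact gagSq_congr_of (z - y) hd

theorem weak_eq_bdd (h : Ctx ω f C β) (u : ℕ → HX) (w : HX)
    (hweak : ∀ z : HX, Tendsto (fun k => inner ℝ (u k) z) atTop (𝓝 (inner ℝ w z)))
    (hae : ∀ᵐ x ∂mu, Tendsto (fun k => rep (u k) x) atTop (𝓝 (rep w x)))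
    {K : ℝ} (hK0 : 0 < K) (hK : ∀ n, ∫ x, f (rep (u n) x) * rep (u n) x ∂mu ≤ K)
    (hD : ∀ z, Tendsto (fun n => DPhi f (u n) z) atTop (𝓝 0)) {v : ℝ → ℝ} (hv : memX v)
    {k : ℝ} (hk : 0 < k) (hvk : ∀ x, |v x| ≤ k) (z : HX) (hrep : rep z =ᵐ[volume] v) : DPhi f w z = 0 := by
  have e : ∀ g : HX, DPhi f g z = inner ℝ g z / (2*π) - ∫ x, f (rep g x) * v x ∂mu := by
    intro g
    unfold DPhi
    have : ∫ x, f (rep g x) * rep z x ∂mu = ∫ x, f (rep g x) * v x ∂mu := by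
      apply integral_congr_ae
      filter_upwards [ae_restrict_of_ae hrep] with x hx
      rw [hx]
    rw [this]
  have h1 := h.limfv u w hae hK0 hK hv hk hvk
  have h2 := ((hweak z).div_const (2*π)).sub h1
  rw [← e w] at h2
  refine tendsto_nhds_unique h2 ?_
  exact (hD z).congr fun n => e (u n)

theorem weak_eq (h : Ctx ω f C β) (u : ℕ → HX) (w : HX)
    (hweak : ∀ z : HX, Tendsto (fun k => inner ℝ (u k) z) atTop (𝓝 (inner ℝ w z)))
    (hae : ∀ᵐ x ∂mu, Tendsto (fun k => rep (u k) x) atTop (𝓝 (rep w x)))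
    {K : ℝ} (hK0 : 0 < K) (hK : ∀ n, ∫ x, f (rep (u n) x) * rep (u n) x ∂mu ≤ K)
    (hD : ∀ z, Tendsto (fun n => DPhi f (u n) z) atTop (𝓝 0)) (z : HX) : DPhi f w z = 0 := by
  have step : ∀ k : ℕ, DPhi f w (toHX _ (trunc_memX (rep_mem z) k)) = 0 := by
    intro k
    exact h.weak_eq_bdd u w hweak hae hK0 hK hD (trunc_memX (rep_mem z) k) (k := (k:ℝ)+1) (by positivity)
      (fun x => (trunc_le (by positivity) _).trans (by linarith)) _ (rep_toHX h.hl1 _ _)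
  have hcont : Continuous (fun y : HX => DPhi f w y) := h.D_cont.comp (Continuous.prodMk_right w)
  have hc := (hcont.tendsto z).comp (trunc_lim z)
  simp only [Function.comp_def] at hc
  simp only [step] at hc
  exact tendsto_nhds_unique hc tendsto_const_nhds

theorem nontriv (h : Ctx ω f C β) {t₀ M : ℝ} (hM0 : 0 < M)
    (hM : ∀ t : ℝ, t₀ ≤ |t| → 0 < primF f t ∧ primF f t ≤ M * |f t|) (u : ℕ → HX)
    (hae : ∀ᵐ x ∂mu, Tendsto (fun k => rep (u k) x) atTop (𝓝 (rep 0 x)))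
    {K : ℝ} (hK0 : 0 < K) (hK : ∀ n, ∫ x, f (rep (u n) x) * rep (u n) x ∂mu ≤ K)
    (hD : Tendsto (fun n => DPhi f (u n) (u n)) atTop (𝓝 0))
    {α₀ c a : ℝ} (hα₀ : 0 < α₀) (hc0 : 0 ≤ c) (hc : c < ω / (2 * α₀)) (ha : 0 < a)
    (hau : ∀ n, a ≤ Phi f (u n)) (huc : ∀ n, Phi f (u n) ≤ c)
    (hgr : ∀ α : ℝ, α₀ < α →
      Tendsto (fun t => |f t| * exp (-α * t ^ 2)) (cocompact ℝ) (𝓝 0)) : False := by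
  have hpi := pi_pos
  have hF := h.limF hM0 hM u 0 hae hK0 hK
  have hF0 : ∫ x, primF f (rep 0 x) ∂mu = 0 := by
    have := h.Phi_zero
    unfold Phi at this
    simpa using this
  rw [hF0] at hF
  obtain ⟨c', hc1, hc2⟩ := exists_between hc
  have hc'0 : 0 < c' := lt_of_le_of_lt hc0 hc1
  set S := 4 * π * c' with hS
  have hS0 : 0 < S := by positivity
  have hS1 : α₀ * S < 2 * π * ω := by
    rw [lt_div_iff₀ (by positivity)] at hc2
    have := mul_lt_mul_of_pos_left hc2 (show 0 < 2 * π by positivity)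
    rw [hS]; linarith
  obtain ⟨α, hα1, hα2⟩ := exists_between hS1
  have hα0 : 0 < α := lt_trans (by positivity) hα1
  set αt := α / S with hαt
  have hαt1 : α₀ < αt := by rw [hαt, lt_div_iff₀ hS0]; exact hα1
  obtain ⟨β', hb1, hb2⟩ := exists_between hαt1
  obtain ⟨C', hC', hg⟩ := growth h.fc.cont (hgr β' hb1)
  obtain ⟨K', hK', hTM⟩ := tm_scaled h.hTM hα0 hα2
  set κ := αt - β' with hκ
  have hκ0 : 0 < κ := by rw [hκ]; linarith
  have hev : ∀ᶠ n in atTop, ‖u n‖^2 ≤ S := by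
    have := hF.eventually (gt_mem_nhds (show 0 < c' - c by linarith))
    filter_upwards [this] with n hn
    have h1 := huc n
    unfold Phi at h1
    have h2 : ‖u n‖^2/(4*π) ≤ c' := by linarith
    rw [div_le_iff₀ (by positivity)] at h2
    rw [hS]; linarith
  obtain ⟨N, hN⟩ := eventually_atTop.1 hev
  have hV : Tendsto (fun n => ∫ x, f (rep (u (n+N)) x) * rep (u (n+N)) x ∂mu) atTop
      (𝓝 (∫ x, f (rep 0 x) * rep 0 x ∂mu)) := by
    apply vitali (fun n x => f (rep (u (n+N)) x) * rep (u (n+N)) x) (fun x => f (rep 0 x) * rep 0 x)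
      (fun n x => exp (αt * (rep (u (n+N)) x)^2)) K' hK' (fun n => h.intff _) (h.intff 0)
    · filter_upwards [hae] with x hx
      have hx' := hx.comp (tendsto_add_atTop_nat N)
      exact ((h.fc.cont.tendsto _).comp hx').mul hx'
    · intro n
      apply hTM _ (rep_mem _) αt (sqrt S) (sqrt_pos.2 hS0)
      · rw [← normsq_rep, sq_sqrt hS0.le]; exact hN _ (by omega)
      · rw [sq_sqrt hS0.le, hαt, div_mul_cancel₀ _ hS0.ne']
    · intro ε hε
      have hcont : Continuous (fun t => f t * t) := h.fc.cont.mul continuous_id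
      obtain ⟨d, _, hd⟩ := pt_ui (G := fun t => f t * t) (W := fun t => exp (αt * t^2)) hcont
        (t0 := 0) (C0 := C'/κ) (by positivity)
        (fun t ht => by
          rw [abs_mul]
          have e1 := hg t
          have e2 := add_one_le_exp (κ * t^2)
          have e3 : t^2 ≤ exp (κ * t^2) / κ := by
            rw [le_div_iff₀ hκ0]; linarith
          have e4 : exp (αt * t^2) = exp (β' * t^2) * exp (κ * t^2) := by
            rw [← exp_add, hκ]; ring_nf
          have e5 : |f t| * |t| * |t| = |f t| * t^2 := by rw [← sq_abs t]; ring
          rw [e4, e5]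
          calc _ ≤ (C' * exp (β' * t^2)) * (exp (κ * t^2) / κ) := by gcongr
            _ = _ := by ring) ε hε
      exact ⟨d, fun n x => hd _⟩
  have h0 : ∫ x, f (rep 0 x) * rep 0 x ∂mu = 0 := by
    rw [← integral_zero ℝ ℝ (μ := mu)]
    apply integral_congr_ae
    filter_upwards [ae_restrict_of_ae (rep_zero h.hl1)] with x hx
    rw [hx]; simp
  rw [h0] at hV
  have hD' := hD.comp (tendsto_add_atTop_nat N)
  have hF' := hF.comp (tendsto_add_atTop_nat N)
  have hP : Tendsto (fun n => Phi f (u (n+N))) atTop (𝓝 0) := by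
    have := ((hD'.add hV).div_const 2).sub hF'
    simp only [add_zero, zero_div, sub_zero] at this
    refine this.congr fun n => ?_
    simp only [Function.comp_apply, Phi, DPhi]
    rw [real_inner_self_eq_norm_sq]
    field_simp
    ring
  exact absurd (ge_of_tendsto' hP fun n => hau _) (by linarith)

end Ctx

/-- critical existence (Theorem 3). -/
theorem statement3 (ω : ℝ) (hω0 : 0 < ω) (hωπ : ω ≤ π) (hTM : TMprop ω)
    (f : ℝ → ℝ) (hf : HypH' f ω) :
    ∃ u : ℝ → ℝ, IsWeakSolution f u ∧ ¬ (u =ᵐ[volume] (fun _ => (0 : ℝ))) := by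
  obtain ⟨hcont, _, ⟨t₀, _, M, hM0, hM⟩, har, hlim, α₀, hα₀, _, hlow, hup, ψ, hψ, hψ1, b, hb, hbs⟩ := hf
  have fc : Fc f := ⟨hcont, har⟩
  obtain ⟨hl1, m, hm0, hm, δ, hδ, hδ2⟩ := fc.small hlim
  obtain ⟨C, hC, hg⟩ := growth hcont (hup (α₀+1) (by linarith))
  have hctx : Ctx ω f C (α₀+1+1) :=
    { hω := hω0
      hTM := hTM
      hl1 := hl1
      fc := fc
      hC := hC
      hβ := by positivity
      gf := fun t => (hg t).trans (by gcongr; linarith)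
      gF := fc.growthF hC hg
      gid := fun t => by
        rw [one_mul]
        refine (abs_le_exp_sq t).trans (exp_le_exp.2 ?_)
        nlinarith [sq_nonneg t] }
  obtain ⟨a, ha, u, h1, h2, h3⟩ := hctx.ps_seq hm0 hm hδ hδ2 (α := α₀/2) (by positivity)
    (hlow (α₀/2) (by positivity) (by linarith)) hψ hψ1 hbs
  have h4 : ∀ n v, |DPhi f (u n) v| ≤ ‖v‖ := by
    intro n v
    refine (h3 n v).trans (mul_le_of_le_one_left (norm_nonneg _) ?_)
    rw [div_le_one (by positivity)]
    have : (0:ℝ) ≤ n := by positivity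
    linarith
  obtain ⟨R, _, K, hK, hRK⟩ := hctx.ps_bdd hM (max b 0) (le_max_right _ _)
  obtain ⟨w, g, hgm, hweak, hae⟩ := hctx.extract u R (fun n => (hRK (u n) (h2 n) (h4 n)).1)
  have hdec : Tendsto (fun n => 1 / ((g n : ℝ)+1)) atTop (𝓝 0) :=
    (tendsto_one_div_add_atTop_nhds_zero_nat (𝕜 := ℝ)).comp hgm.tendsto_atTop
  have hD : ∀ z, Tendsto (fun n => DPhi f (u (g n)) z) atTop (𝓝 0) := by
    intro z
    apply squeeze_zero_norm (fun n => h3 (g n) z)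
    simpa using hdec.mul_const ‖z‖
  have hDu : Tendsto (fun n => DPhi f (u (g n)) (u (g n))) atTop (𝓝 0) := by
    apply squeeze_zero_norm (a := fun n => 1 / ((g n : ℝ)+1) * R)
    · intro n
      refine (h3 (g n) _).trans ?_
      gcongr
      exact (hRK _ (h2 _) (h4 _)).1
    · simpa using hdec.mul_const R
  have hKs : ∀ n, ∫ x, f (rep (u (g n)) x) * rep (u (g n)) x ∂mu ≤ K :=
    fun n => (hRK _ (h2 _) (h4 _)).2
  have hw := hctx.weak_eq (fun n => u (g n)) w hweak hae hK hKs hD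
  refine ⟨rep w, ⟨rep_mem w, fun v hv => ⟨hctx.intfv (rep_mem w) hv, ?_⟩⟩, fun h0 => ?_⟩
  · have h5 := hw (toHX v hv)
    unfold DPhi at h5
    rw [inner_eq_of w (toHX v hv) (rep_spec w) (toHX_spec v hv)] at h5
    rw [sub_eq_zero.1 h5]
    apply integral_congr_ae
    filter_upwards [ae_restrict_of_ae (rep_toHX hl1 v hv)] with x hx
    rw [hx]
  · have hae0 : ∀ᵐ x ∂mu, Tendsto (fun k => rep (u (g k)) x) atTop (𝓝 (rep 0 x)) := by
      filter_upwards [hae, ae_restrict_of_ae h0, ae_restrict_of_ae (rep_zero hl1)] with x e1 e2 e3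
      rw [e3, ← e2]; exact e1
    exact hctx.nontriv hM0 hM (fun n => u (g n)) hae0 hK hKs hDu hα₀ (le_max_right b 0)
      (max_lt hb (by positivity)) ha (fun n => h1 _) (fun n => h2 _) hup
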